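/- There exists a universal constant c > 0 such that for every integer n ≥ 2 and every predicate D : {0,1,...,n} → {−1,1}, the 2^n × 2^n sign matrix F indexed by x, y ∈ {0,1}^n with entries F(x,y) = D(|x ⊕ y|) satisfies log₂ rk±(F) ≥ c · deg₂(D) / (log₂ n)^5. (By the Paturi–Simon characterization U(f) = log₂ rk±(f) + O(1), this is the lower bound of the main theorem: the unbounded-error communication complexity of the symmetric XOR function f^⊕_D is at least Ω(deg₂(D)/log^5 n).) -/

import Mathlib

/-- Hamming weight of a Boolean vector. -/
def hamW {n : ℕ} (x : Fin n → Bool) : ℕ := (Finset.univ.filter (fun i => x i)).card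

/-- Bitwise XOR of Boolean vectors. -/
def bxor {n : ℕ} (x y : Fin n → Bool) : Fin n → Bool := fun i => xor (x i) (y i)

/-- Bitwise AND of Boolean vectors. -/
def band {n : ℕ} (x y : Fin n → Bool) : Fin n → Bool := fun i => x i && y i

/-- Sign-rank of a real sign matrix `F`: the least rank of a real matrix `A`
of the same dimensions all of whose entries are nonzero and have the same sign
as the corresponding entry of `F`. -/
noncomputable def signRank {X Y : Type} [Fintype X] [Fintype Y]
    (F : Matrix X Y ℝ) : ℕ :=
  sInf {r : ℕ | ∃ A : Matrix X Y ℝ, (∀ x y, 0 < A x y * F x y) ∧ A.rank = r}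

open Matrix Finset in
/-- Adding a nonnegative multiple of a rank-one matrix to a positive definite matrix multiplies the
determinant by `1 + c uᵀ P⁻¹ u`. -/
theorem det_add_smul_vecMulVec {R : ℕ} (P : Matrix (Fin R) (Fin R) ℝ) (hP : P.PosDef)
    (c : ℝ) (u : Fin R → ℝ) :
    (P + c • vecMulVec u u).det = P.det * (1 + c * (u ⬝ᵥ (P⁻¹ *ᵥ u))) := by
  have h := det_add_replicateCol_mul_replicateRow (ι := Unit) (A := P) hP.det_pos.ne'.isUnit
    (c • u) u
  have h1 : replicateCol Unit (c • u) * replicateRow Unit u = c • vecMulVec u u := by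
    ext i j
    simp [Matrix.mul_apply, vecMulVec_apply, mul_assoc]
  rw [h1] at h
  rw [h, det_unique (n := Unit)]
  congr 1
  simp [Matrix.mul_apply, dotProduct, mulVec, Finset.sum_mul, Finset.mul_sum]
  rw [Finset.sum_comm]
  refine Finset.sum_congr rfl fun i _ => Finset.sum_congr rfl fun j _ => by ring

open Matrix Finset in
theorem posSemidef_smul_vecMulVec {R : ℕ} {c : ℝ} (hc : 0 ≤ c) (u : Fin R → ℝ) :
    (c • vecMulVec u u).PosSemidef := by
  simpa using (posSemidef_vecMulVec_self_star u).smul hc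

open Matrix Finset in
theorem det_le_det_add_sum {R : ℕ} {X : Type*} [DecidableEq X] (P : Matrix (Fin R) (Fin R) ℝ)
    (hP : P.PosDef) (c : X → ℝ) (hc : ∀ x, 0 ≤ c x) (u : X → Fin R → ℝ) (s : Finset X) :
    P.det ≤ (P + ∑ x ∈ s, c x • vecMulVec (u x) (u x)).det := by
  induction s using Finset.induction_on with
  | empty => simp
  | insert x s hx ih =>
    have hpd : (P + ∑ x ∈ s, c x • vecMulVec (u x) (u x)).PosDef :=
      hP.add_posSemidef (posSemidef_sum s fun y _ => posSemidef_smul_vecMulVec (hc y) (u y))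
    rw [sum_insert hx, add_comm (c x • _), ← add_assoc, det_add_smul_vecMulVec _ hpd]
    refine ih.trans (le_mul_of_one_le_right hpd.det_pos.le ?_)
    have := hpd.inv.posSemidef.dotProduct_mulVec_nonneg (u x)
    simp only [star_trivial] at this
    nlinarith [mul_nonneg (hc x) this]

open Matrix Finset in
/-- Lower bound on the determinant of a weighted Gram sum by the contribution of `R` of its
vectors, together with its positive definiteness. -/
theorem det_weighted_gram_lower {R : ℕ} {X : Type*} [Fintype X] [DecidableEq X] (c : X → ℝ)
    (hc : ∀ x, 0 < c x) (u : X → Fin R → ℝ) (s : Fin R → X) (hs : Function.Injective s)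
    (hdet : (Matrix.of fun i => u (s i)).det ≠ 0) :
    (∑ x, c x • vecMulVec (u x) (u x)).PosDef ∧
    (∏ i, c (s i)) * (Matrix.of fun i => u (s i)).det ^ 2 ≤
      (∑ x, c x • vecMulVec (u x) (u x)).det := by
  set U : Matrix (Fin R) (Fin R) ℝ := Matrix.of fun i => u (s i) with hU
  have hPeq : ∑ i, c (s i) • vecMulVec (u (s i)) (u (s i)) =
      Uᴴ * diagonal (fun i => c (s i)) * U := by
    ext i j
    simp [Matrix.mul_apply, Matrix.sum_apply, vecMulVec_apply, diagonal_apply, hU]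
    refine Finset.sum_congr rfl fun k _ => by ring
  have hPpd : (Uᴴ * diagonal (fun i => c (s i)) * U).PosDef := by
    refine PosDef.conjTranspose_mul_mul_same (PosDef.diagonal fun i => hc _) ?_
    exact Matrix.mulVec_injective_of_isUnit ((Matrix.isUnit_iff_isUnit_det _).2 hdet.isUnit)
  have hsplit : ∑ x, c x • vecMulVec (u x) (u x) =
      Uᴴ * diagonal (fun i => c (s i)) * U +
        ∑ x ∈ univ \ univ.image s, c x • vecMulVec (u x) (u x) := by
    rw [← hPeq, ← Finset.sum_image (f := fun x => c x • vecMulVec (u x) (u x))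
      (fun a _ b _ h => hs h), add_comm, Finset.sum_sdiff (subset_univ _)]
  rw [hsplit]
  refine ⟨hPpd.add_posSemidef (posSemidef_sum _ fun y _ =>
    posSemidef_smul_vecMulVec (hc y).le (u y)), ?_⟩
  refine le_trans (le_of_eq ?_) (det_le_det_add_sum _ hPpd c (fun x => (hc x).le) u _)
  rw [det_mul, det_mul, det_conjTranspose, det_diagonal]
  simp
  ring

/-- Some `r`-element subset of a finite set has at least the average sum. -/
theorem exists_subset_card_eq_average_le {X : Type*} [DecidableEq X] (y : X → ℝ) (k r : ℕ)
    (A : Finset X) (hA : A.card = r + k) :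
    ∃ S ⊆ A, S.card = r ∧ (r : ℝ) * ∑ x ∈ A, y x ≤ A.card * ∑ x ∈ S, y x := by
  induction k generalizing A with
  | zero => exact ⟨A, subset_rfl, hA, by simp [hA]⟩
  | succ k ih =>
    have hne : A.Nonempty := Finset.card_pos.1 (by omega)
    obtain ⟨m, hm, hmin⟩ := A.exists_min_image y hne
    have hc : (A.erase m).card = r + k := by rw [Finset.card_erase_of_mem hm]; omega
    obtain ⟨S, hS, hSr, h⟩ := ih (A.erase m) hc
    refine ⟨S, hS.trans (Finset.erase_subset _ _), hSr, ?_⟩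
    have h1 : y m + ∑ x ∈ A.erase m, y x = ∑ x ∈ A, y x := Finset.add_sum_erase _ _ hm
    have h2 : (A.card : ℝ) * y m ≤ ∑ x ∈ A, y x := by
      simpa using Finset.card_nsmul_le_sum A y (y m) hmin
    have hA' : (A.card : ℝ) = r + k + 1 := by rw [hA]; push_cast; ring
    have hc' : ((A.erase m).card : ℝ) = r + k := by rw [hc]; push_cast; ring
    rw [hc', eq_sub_of_add_eq' h1] at h
    rw [hA'] at h2 ⊢
    rcases Nat.eq_zero_or_pos (r + k) with h0 | h0
    · have : r = 0 := by omega
      subst this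
      rw [Finset.card_eq_zero] at hSr
      simp [hSr]
    · have h0' : (0 : ℝ) < r + k := by exact_mod_cast h0
      have hr : (0 : ℝ) ≤ r := r.cast_nonneg
      refine le_of_mul_le_mul_left ?_ h0'
      nlinarith [mul_le_mul_of_nonneg_left h (by positivity : (0 : ℝ) ≤ r + k + 1),
        mul_le_mul_of_nonneg_left h2 hr]

open Matrix Finset in
/-- Vectors in general position have positive weights for which all leverage scores agree. -/
theorem exists_isotropic_weights {R : ℕ} {X : Type*} [Fintype X] [DecidableEq X]
    (u : X → Fin R → ℝ) (hR : 0 < R) (hRX : R < Fintype.card X)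
    (hgen : ∀ s : Fin R → X, Function.Injective s → (Matrix.of fun i => u (s i)).det ≠ 0) :
    ∃ c : X → ℝ, (∀ x, 0 < c x) ∧ (∑ x, c x • vecMulVec (u x) (u x)).PosDef ∧
      ∀ x, c x * (u x ⬝ᵥ ((∑ x, c x • vecMulVec (u x) (u x))⁻¹ *ᵥ u x)) =
        R / Fintype.card X := by
  set N := Fintype.card X with hN
  set Q : (X → ℝ) → Matrix (Fin R) (Fin R) ℝ :=
    fun y => ∑ x, Real.exp (y x) • vecMulVec (u x) (u x) with hQ
  have hNR : (0 : ℝ) < N - R := sub_pos.2 (by exact_mod_cast hRX)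
  have hN0 : (0 : ℝ) < N := by exact_mod_cast hR.trans hRX
  have hR1 : (1 : ℝ) ≤ R := by exact_mod_cast hR
  have hN1 : (0 : ℝ) < N - 1 := by linarith
  -- injections from `Fin R` onto a given `R`-subset
  have hinj : ∀ S : Finset X, S.card = R → ∃ s : Fin R → X, Function.Injective s ∧
      ∀ g : X → ℝ, ∑ i, g (s i) = ∑ x ∈ S, g x := by
    intro S hS
    let e : Fin R ≃ S := (S.equivFinOfCardEq hS).symm
    refine ⟨fun i => (e i : X), fun a b h => e.injective (Subtype.ext h), fun g => ?_⟩
    rw [← Finset.sum_coe_sort S g]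
    exact Equiv.sum_comp e (fun x : S => g x)
  obtain ⟨S₀, -, hS₀⟩ := Finset.exists_subset_card_eq (s := (univ : Finset X)) (n := R)
    (by rw [card_univ]; exact hRX.le)
  obtain ⟨s₀, hs₀, -⟩ := hinj S₀ hS₀
  have hpd : ∀ y, (Q y).PosDef := fun y =>
    (det_weighted_gram_lower _ (fun x => Real.exp_pos _) u s₀ hs₀ (hgen s₀ hs₀)).1
  obtain ⟨δ, hδ, hδle⟩ : ∃ δ : ℝ, 0 < δ ∧ ∀ s : Fin R → X, Function.Injective s →
      δ ≤ (Matrix.of fun i => u (s i)).det ^ 2 := by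
    classical
    obtain ⟨s, hs, hmin⟩ := (univ.filter fun s : Fin R → X => Function.Injective s).exists_min_image
      (fun s => (Matrix.of fun i => u (s i)).det ^ 2) ⟨s₀, by simpa using hs₀⟩
    refine ⟨_, ?_, fun s' hs' => hmin s' (by simpa using hs')⟩
    have := hgen s (by simpa using hs)
    positivity
  set f : (X → ℝ) → ℝ := fun y => Real.log (Q y).det - R / N * ∑ x, y x with hf
  have hfcont : Continuous f := by
    refine Continuous.sub (Continuous.log ?_ fun y => (hpd y).det_pos.ne') (by fun_prop)
    refine Continuous.matrix_det ?_
    simp only [hQ]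
    fun_prop
  -- coercivity
  have hco : ∀ y : X → ℝ, ∑ x, y x = 0 → ∀ x₀,
      (N - R) * y x₀ ≤ (N - 1) * (f y - Real.log δ) := by
    intro y hy x₀
    have hcard : (univ.erase x₀).card = (R - 1) + (N - R) := by
      rw [card_erase_of_mem (mem_univ _), card_univ]; omega
    obtain ⟨S, hS, hSc, h⟩ := exists_subset_card_eq_average_le y (N - R) (R - 1) _ hcard
    have hx₀ : x₀ ∉ S := fun h => by simpa using hS h
    obtain ⟨s, hs, hsum⟩ := hinj (insert x₀ S) (by rw [card_insert_of_notMem hx₀]; omega)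
    have h1 := (det_weighted_gram_lower (fun x => Real.exp (y x)) (fun x => Real.exp_pos _) u s hs
      (hgen s hs)).2
    rw [← Real.exp_sum, hsum y, sum_insert hx₀] at h1
    have h2 : Real.exp (y x₀ + ∑ x ∈ S, y x) * δ ≤ (Q y).det :=
      le_trans (mul_le_mul_of_nonneg_left (hδle s hs) (Real.exp_pos _).le) h1
    have h3 := Real.log_le_log (by positivity) h2
    rw [Real.log_mul (Real.exp_pos _).ne' hδ.ne', Real.log_exp] at h3
    have h4 : y x₀ + ∑ x ∈ univ.erase x₀, y x = ∑ x, y x := Finset.add_sum_erase _ _ (mem_univ _)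
    rw [hcard, eq_sub_of_add_eq' h4, hy] at h
    have hc1 : ((R - 1 + (N - R) : ℕ) : ℝ) = N - 1 := by
      have : (R - 1 + (N - R) : ℕ) + 1 = N := by omega
      rw [eq_sub_iff_add_eq]; exact_mod_cast this
    rw [hc1, Nat.cast_sub hR] at h
    push_cast at h
    have hfy : f y = Real.log (Q y).det := by simp [hf, hy]
    rw [hfy]
    nlinarith
  -- a minimiser on the hyperplane
  obtain ⟨y, hysum, hymin⟩ : ∃ y : X → ℝ, ∑ x, y x = 0 ∧
      ∀ z : X → ℝ, ∑ x, z x = 0 → f y ≤ f z := by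
    set M : ℝ := (N - 1) * (f 0 - Real.log δ) / (N - R) with hM
    set K : Set (X → ℝ) := {y | ∑ x, y x = 0 ∧ f y ≤ f 0} with hK
    have hle : ∀ y ∈ K, ∀ x, y x ≤ M := by
      rintro y ⟨hy, hy'⟩ x
      rw [hM, le_div_iff₀ hNR]
      nlinarith [hco y hy x]
    have hKc : IsCompact K := by
      refine IsCompact.of_isClosed_subset (isCompact_Icc (a := fun _ : X => -((N - 1) * M))
        (b := fun _ : X => M)) ?_ ?_
      · exact (isClosed_eq (by fun_prop) continuous_const).inter
          (isClosed_le hfcont continuous_const)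
      · intro y hy
        refine ⟨fun x => ?_, hle y hy⟩
        have h4 : y x + ∑ z ∈ univ.erase x, y z = ∑ z, y z :=
          Finset.add_sum_erase _ _ (mem_univ _)
        have h5 : ∑ z ∈ univ.erase x, y z ≤ (univ.erase x).card • M :=
          Finset.sum_le_card_nsmul _ _ _ fun z _ => hle y hy z
        rw [card_erase_of_mem (mem_univ _), card_univ, nsmul_eq_mul, ← hN,
          Nat.cast_sub (by omega)] at h5
        rw [hy.1] at h4
        push_cast at h5
        show -((N - 1) * M) ≤ y x
        linarith
    obtain ⟨y, hy, hmin⟩ := hKc.exists_isMinOn ⟨0, by simp [hK]⟩ hfcont.continuousOn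
    refine ⟨y, hy.1, fun z hz => ?_⟩
    by_cases h : f z ≤ f 0
    · exact hmin ⟨hz, h⟩
    · exact hy.2.trans (not_le.1 h).le
  have hglob : ∀ z, f y ≤ f z := by
    intro z
    set a : ℝ := (∑ x, z x) / N with ha
    have h0 : ∑ x, (z x - a) = 0 := by
      rw [Finset.sum_sub_distrib, sum_const, card_univ, nsmul_eq_mul, ← hN, ha]
      field_simp
      ring
    refine (hymin _ h0).trans (le_of_eq ?_)
    have hQz : Q z = Real.exp a • Q (fun x => z x - a) := by
      simp only [hQ, Finset.smul_sum, smul_smul, ← Real.exp_add]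
      simp
    simp only [hf]
    rw [hQz, det_smul, Real.log_mul (by positivity) (hpd _).det_pos.ne', Real.log_pow, Real.log_exp,
      h0, Fintype.card_fin]
    have hs : ∑ x, z x = N * a := by rw [ha]; field_simp
    rw [hs]
    generalize Real.log (Q fun x => z x - a).det = L
    generalize a = a'
    field_simp
    ring
  refine ⟨fun x => Real.exp (y x), fun x => Real.exp_pos _, hpd y, fun x => ?_⟩
  set q := u x ⬝ᵥ ((Q y)⁻¹ *ᵥ u x) with hq
  show Real.exp (y x) * q = R / N
  have hQt : ∀ t : ℝ, Q (Function.update y x (y x + t)) =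
      Q y + (Real.exp (y x + t) - Real.exp (y x)) • vecMulVec (u x) (u x) := by
    intro t
    simp only [hQ]
    rw [← Finset.add_sum_erase _ _ (mem_univ x), ← Finset.add_sum_erase _ _ (mem_univ x)]
    rw [Finset.sum_congr rfl (fun z hz => by
      rw [Function.update_of_ne (Finset.ne_of_mem_erase hz)])]
    rw [Function.update_self, sub_smul]
    abel
  have hsumt : ∀ t : ℝ, ∑ z, Function.update y x (y x + t) z = t := by
    intro t
    rw [← Finset.add_sum_erase _ _ (mem_univ x)] at hysum ⊢
    rw [Finset.sum_congr rfl (fun z hz => by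
      rw [Function.update_of_ne (Finset.ne_of_mem_erase hz)]), Function.update_self]
    linarith
  have hpos : ∀ t : ℝ, 0 < 1 + (Real.exp (y x + t) - Real.exp (y x)) * q := by
    intro t
    have h := (hpd (Function.update y x (y x + t))).det_pos
    rw [hQt, det_add_smul_vecMulVec _ (hpd y)] at h
    exact pos_of_mul_pos_right h (hpd y).det_pos.le
  have hft : ∀ t : ℝ, f (Function.update y x (y x + t)) = Real.log (Q y).det +
      Real.log (1 + (Real.exp (y x + t) - Real.exp (y x)) * q) - R / N * t := by
    intro t
    simp only [hf]
    rw [hsumt, hQt, det_add_smul_vecMulVec _ (hpd y),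
      Real.log_mul (hpd y).det_pos.ne' (hpos t).ne']
  have hmin : IsLocalMin (fun t : ℝ => Real.log (Q y).det +
      Real.log (1 + (Real.exp (y x + t) - Real.exp (y x)) * q) - R / N * t) 0 := by
    refine Filter.Eventually.of_forall fun t => ?_
    simp only [← hft]
    simpa using hglob _
  have hder : HasDerivAt (fun t : ℝ => Real.log (Q y).det +
      Real.log (1 + (Real.exp (y x + t) - Real.exp (y x)) * q) - R / N * t)
      (Real.exp (y x) * q - R / N) 0 := by
    have h1 : HasDerivAt (fun t : ℝ => 1 + (Real.exp (y x + t) - Real.exp (y x)) * q)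
        (Real.exp (y x) * q) 0 := by
      have := (((hasDerivAt_id (0 : ℝ)).const_add (y x)).exp.sub_const (Real.exp (y x))).mul_const q
      simpa using this.const_add 1
    have h2 := h1.log (hpos 0).ne'
    have h3 := (h2.const_add (Real.log (Q y).det)).sub
      ((hasDerivAt_id (0 : ℝ)).const_mul ((R : ℝ) / N))
    have h4 := h3.congr_deriv (g' := Real.exp (y x) * q - R / N) (by simp)
    exact h4
  linarith [hmin.hasDerivAt_eq_zero hder]

/-- Forster's inequality for normalized vector systems. -/
theorem forster_of_normalized {R : ℕ} {X Y : Type*} [Fintype X] [Fintype Y] [Nonempty X]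
    [Nonempty Y] (M : X → Y → ℝ) (u : X → Fin R → ℝ) (v : Y → Fin R → ℝ) {γ K : ℝ}
    (hγ : 0 < γ) (hM : ∀ x y, γ ≤ |M x y|) (hsign : ∀ x y, 0 < M x y * ∑ k, u x k * v y k)
    (hR : 0 < R)
    (hK : ∀ (f : X → ℝ) (g : Y → ℝ),
      (∑ x, ∑ y, M x y * f x * g y) ^ 2 ≤ K * (∑ x, f x ^ 2) * ∑ y, g y ^ 2)
    (hu1 : ∀ k, ∑ x, u x k ^ 2 = 1) (hu2 : ∀ x, ∑ k, u x k ^ 2 = R / Fintype.card X)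
    (hv : ∀ y, ∑ k, v y k ^ 2 = 1) (huv : ∀ y, ∑ x, (∑ k, u x k * v y k) ^ 2 = 1) :
    γ ^ 2 * (Fintype.card X * Fintype.card Y) ≤ K * R ^ 2 := by
  have hN : (0 : ℝ) < Fintype.card X := by exact_mod_cast Fintype.card_pos
  have hY : (0 : ℝ) < Fintype.card Y := by exact_mod_cast Fintype.card_pos
  have hR' : (0 : ℝ) < R := by exact_mod_cast hR
  set s : ℝ := √(R / Fintype.card X) with hs
  have hs0 : 0 < s := Real.sqrt_pos.2 (by positivity)
  have hs2 : s ^ 2 = R / Fintype.card X := Real.sq_sqrt (by positivity)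
  have hle : ∀ x y, |∑ k, u x k * v y k| ≤ s := by
    intro x y
    refine abs_le_of_sq_le_sq ?_ hs0.le
    rw [hs2, ← hu2 x, ← mul_one (∑ k, u x k ^ 2), ← hv y]
    exact Finset.sum_mul_sq_le_sq_mul_sq _ _ _
  have hlow : γ * Fintype.card Y ≤ s * ∑ x, ∑ y, M x y * ∑ k, u x k * v y k := by
    have h1 : (Fintype.card Y : ℝ) = ∑ x, ∑ y, (∑ k, u x k * v y k) ^ 2 := by
      rw [Finset.sum_comm]
      simp [huv]
    rw [h1]
    simp only [Finset.mul_sum (s := Finset.univ (α := Y)),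
      Finset.mul_sum (s := Finset.univ (α := X))]
    refine Finset.sum_le_sum fun x _ => Finset.sum_le_sum fun y _ => ?_
    have h2 : M x y * ∑ k, u x k * v y k = |M x y| * |∑ k, u x k * v y k| := by
      rw [← abs_mul, abs_of_pos (hsign x y)]
    rw [h2, ← sq_abs]
    have h3 := hle x y
    have h4 := hM x y
    have h5 := abs_nonneg (∑ k, u x k * v y k)
    calc γ * |∑ k, u x k * v y k| ^ 2 = γ * |∑ k, u x k * v y k| * |∑ k, u x k * v y k| := by ring
      _ ≤ |M x y| * |∑ k, u x k * v y k| * s := by gcongr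
      _ = _ := by ring
  have hup : (∑ x, ∑ y, M x y * ∑ k, u x k * v y k) ^ 2 ≤ R * (K * Fintype.card Y) := by
    have h1 : ∑ x, ∑ y, M x y * ∑ k, u x k * v y k =
        ∑ k, ∑ x, ∑ y, M x y * u x k * v y k := by
      rw [Finset.sum_comm (s := (Finset.univ : Finset (Fin R)))]
      refine Finset.sum_congr rfl fun x _ => ?_
      rw [Finset.sum_comm (s := (Finset.univ : Finset (Fin R)))]
      refine Finset.sum_congr rfl fun y _ => ?_
      rw [Finset.mul_sum]
      exact Finset.sum_congr rfl fun k _ => by ring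
    rw [h1]
    refine (sq_sum_le_card_mul_sum_sq).trans ?_
    rw [Finset.card_univ, Fintype.card_fin]
    refine mul_le_mul_of_nonneg_left ?_ hR'.le
    have h2 : K * (Fintype.card Y : ℝ) = ∑ k, K * 1 * ∑ y, v y k ^ 2 := by
      rw [← Finset.mul_sum, Finset.sum_comm]
      simp [hv]
    rw [h2]
    refine Finset.sum_le_sum fun k _ => ?_
    rw [← hu1 k]
    exact hK (fun x => u x k) (fun y => v y k)
  set T := ∑ x, ∑ y, M x y * ∑ k, u x k * v y k
  have h1 : (γ * Fintype.card Y) ^ 2 ≤ (s * T) ^ 2 := pow_le_pow_left₀ (by positivity) hlow 2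
  rw [mul_pow s, hs2] at h1
  have h2 : (γ * Fintype.card Y) ^ 2 ≤ R / Fintype.card X * (R * (K * Fintype.card Y)) :=
    h1.trans (mul_le_mul_of_nonneg_left hup (by positivity))
  rw [div_mul_eq_mul_div, le_div_iff₀ hN] at h2
  refine le_of_mul_le_mul_right ?_ hY
  linarith

open Matrix MatrixOrder in
/-- Forster's inequality for a sign-representing system in general position. -/
theorem forster_of_general_position {R : ℕ} {X Y : Type*} [Fintype X] [Fintype Y]
    [Nonempty X] [Nonempty Y] (M : X → Y → ℝ) (u : X → Fin R → ℝ) (v : Y → Fin R → ℝ) {γ K : ℝ}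
    (hγ : 0 < γ) (hM : ∀ x y, γ ≤ |M x y|) (hsign : ∀ x y, 0 < M x y * (u x ⬝ᵥ v y))
    (hR : 0 < R) (hRX : R < Fintype.card X)
    (hgen : ∀ s : Fin R → X, Function.Injective s → (Matrix.of fun i => u (s i)).det ≠ 0)
    (hK : ∀ (f : X → ℝ) (g : Y → ℝ),
      (∑ x, ∑ y, M x y * f x * g y) ^ 2 ≤ K * (∑ x, f x ^ 2) * ∑ y, g y ^ 2) :
    γ ^ 2 * (Fintype.card X * Fintype.card Y) ≤ K * R ^ 2 := by
  classical
  obtain ⟨c, hc, hQ, hlev⟩ := exists_isotropic_weights u hR hRX hgen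
  set Q := ∑ x, c x • vecMulVec (u x) (u x) with hQdef
  obtain ⟨B, hBu, hB⟩ : ∃ B : Matrix (Fin R) (Fin R) ℝ, IsUnit B ∧ Q = Bᵀ * B := by
    obtain ⟨B, hBu, hB⟩ :=
      CStarAlgebra.isStrictlyPositive_iff_eq_star_mul_self.1 hQ.isStrictlyPositive
    exact ⟨B, hBu, by rw [hB, star_eq_conjTranspose, conjTranspose_eq_transpose_of_trivial]⟩
  have hdetB : IsUnit B.det := (Matrix.isUnit_iff_isUnit_det _).1 hBu
  have hdetBt : IsUnit Bᵀ.det := by rwa [det_transpose]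
  set C := Bᵀ⁻¹ with hC
  have hCBt : C * Bᵀ = 1 := nonsing_inv_mul _ hdetBt
  have hCtB : Cᵀ * B = 1 := by
    rw [hC, transpose_nonsing_inv, transpose_transpose]; exact nonsing_inv_mul _ hdetB
  have hBCt : B * Cᵀ = 1 := mul_eq_one_comm.1 hCtB
  have hCQC : C * Q * Cᵀ = 1 := by
    rw [hB, ← mul_assoc C, hCBt, one_mul, hBCt]
  have hCC : Cᵀ * C = Q⁻¹ := by
    rw [hB, Matrix.mul_inv_rev, hC, transpose_nonsing_inv, transpose_transpose]
  have hadj : ∀ (A B : Matrix (Fin R) (Fin R) ℝ) (a b : Fin R → ℝ),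
      A *ᵥ a ⬝ᵥ B *ᵥ b = a ⬝ᵥ (Aᵀ * B) *ᵥ b := fun A B a b => by
    rw [dotProduct_mulVec, vecMul_mulVec, ← dotProduct_mulVec]
  have hdot : ∀ x y, C *ᵥ u x ⬝ᵥ B *ᵥ v y = u x ⬝ᵥ v y := fun x y => by
    rw [hadj, hCtB, one_mulVec]
  have hw : ∀ y, 0 < B *ᵥ v y ⬝ᵥ B *ᵥ v y := by
    intro y
    refine (dotProduct_star_self_pos_iff (v := B *ᵥ v y)).2 ?_
    intro h
    have h1 := hsign (Classical.arbitrary X) y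
    rw [← hdot, h] at h1
    simp at h1
  have hiso : ∀ i j, ∑ x, c x * ((C *ᵥ u x) i * (C *ᵥ u x) j) = if i = j then 1 else 0 := by
    intro i j
    have h1 : C * Q * Cᵀ = ∑ x, c x • vecMulVec (C *ᵥ u x) (C *ᵥ u x) := by
      rw [hQdef, Matrix.mul_sum, Matrix.sum_mul]
      refine Finset.sum_congr rfl fun x _ => ?_
      rw [Matrix.mul_smul, Matrix.smul_mul, mul_vecMulVec, vecMulVec_mul, vecMul_transpose]
    rw [hCQC] at h1
    have h2 := congrFun (congrFun h1 i) j
    rw [one_apply] at h2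
    rw [h2]
    simp [Matrix.sum_apply, vecMulVec_apply]
  have hw1 : ∀ y, ∑ k, ((√(B *ᵥ v y ⬝ᵥ B *ᵥ v y))⁻¹ * (B *ᵥ v y) k) ^ 2 = 1 := by
    intro y
    simp only [mul_pow, inv_pow, Real.sq_sqrt (hw y).le]
    rw [← Finset.mul_sum, inv_mul_eq_one₀ (hw y).ne']
    exact Finset.sum_congr rfl fun k _ => (sq _).symm
  have hprod : ∀ x y, ∑ k, √(c x) * (C *ᵥ u x) k *
      ((√(B *ᵥ v y ⬝ᵥ B *ᵥ v y))⁻¹ * (B *ᵥ v y) k) =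
      √(c x) * (√(B *ᵥ v y ⬝ᵥ B *ᵥ v y))⁻¹ * (u x ⬝ᵥ v y) := by
    intro x y
    rw [← hdot]
    generalize (√(B *ᵥ v y ⬝ᵥ B *ᵥ v y))⁻¹ = a
    rw [dotProduct, Finset.mul_sum]
    exact Finset.sum_congr rfl fun k _ => by ring
  refine forster_of_normalized M (fun x k => √(c x) * (C *ᵥ u x) k)
    (fun y k => (√(B *ᵥ v y ⬝ᵥ B *ᵥ v y))⁻¹ * (B *ᵥ v y) k) hγ hM ?_ hR hK ?_ ?_ hw1 ?_
  · intro x y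
    rw [hprod, mul_left_comm]
    have h1 := Real.sqrt_pos.2 (hc x)
    have h2 := Real.sqrt_pos.2 (hw y)
    have h3 := hsign x y
    positivity
  · intro k
    refine Eq.trans ?_ ((hiso k k).trans (if_pos rfl))
    exact Finset.sum_congr rfl fun x _ => by rw [mul_pow, Real.sq_sqrt (hc _).le, sq]
  · intro x
    rw [← hlev x, ← hCC, ← hadj, dotProduct, Finset.mul_sum]
    exact Finset.sum_congr rfl fun k _ => by rw [mul_pow, Real.sq_sqrt (hc _).le, sq]
  · intro y
    have h1 : ∀ w : Fin R → ℝ, ∑ x, (∑ k, √(c x) * (C *ᵥ u x) k * w k) ^ 2 = ∑ k, w k ^ 2 := by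
      intro w
      have h2 : ∀ x, (∑ k, √(c x) * (C *ᵥ u x) k * w k) ^ 2 =
          ∑ i, ∑ j, w i * w j * (c x * ((C *ᵥ u x) i * (C *ᵥ u x) j)) := by
        intro x
        rw [sq, Finset.sum_mul_sum]
        refine Finset.sum_congr rfl fun i _ => Finset.sum_congr rfl fun j _ => ?_
        linear_combination (w i * w j * ((C *ᵥ u x) i * (C *ᵥ u x) j)) *
          Real.mul_self_sqrt (hc x).le
      simp only [h2]
      rw [Finset.sum_comm]
      refine Finset.sum_congr rfl fun i _ => ?_
      rw [Finset.sum_comm]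
      simp only [← Finset.mul_sum, hiso]
      simp [sq]
    rw [h1, hw1]

open Matrix in
/-- A real matrix of rank `R` is a product of matrices with inner dimension `R`. -/
theorem exists_dotProduct_of_rank {X Y : Type*} [Fintype X] [Fintype Y] (A : Matrix X Y ℝ) :
    ∃ (u : X → Fin A.rank → ℝ) (v : Y → Fin A.rank → ℝ), ∀ x y, A x y = u x ⬝ᵥ v y := by
  set S := Submodule.span ℝ (Set.range A.col)
  let b : Module.Basis (Fin A.rank) ℝ S :=
    Module.finBasisOfFinrankEq ℝ S A.rank_eq_finrank_span_cols.symm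
  refine ⟨fun x k => (b k : X → ℝ) x,
    fun y k => b.repr ⟨A.col y, Submodule.subset_span ⟨y, rfl⟩⟩ k, fun x y => ?_⟩
  have h := congrArg (fun s : S => (s : X → ℝ) x)
    (b.sum_repr ⟨A.col y, Submodule.subset_span ⟨y, rfl⟩⟩)
  simp only [Submodule.coe_sum, Finset.sum_apply, Submodule.coe_smul, Pi.smul_apply,
    smul_eq_mul] at h
  rw [dotProduct, show A x y = A.col y x from rfl, ← h]
  exact Finset.sum_congr rfl fun k _ => mul_comm _ _

open Matrix Filter Topology Polynomial in
/-- Finitely many vectors can be brought into general position by a small perturbation that keeps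
finitely many strict sign conditions. -/
theorem exists_general_position {R : ℕ} {X Y : Type*} [Fintype X] [Fintype Y]
    (M : X → Y → ℝ) (u : X → Fin R → ℝ) (v : Y → Fin R → ℝ)
    (hsign : ∀ x y, 0 < M x y * (u x ⬝ᵥ v y)) :
    ∃ u' : X → Fin R → ℝ, (∀ x y, 0 < M x y * (u' x ⬝ᵥ v y)) ∧
      ∀ s : Fin R → X, Function.Injective s → (Matrix.of fun i => u' (s i)).det ≠ 0 := by
  classical
  let τ : X → ℝ := fun x => (Fintype.equivFin X x : ℕ)
  have hτ : Function.Injective τ := fun a b h =>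
    (Fintype.equivFin X).injective (Fin.ext (Nat.cast_injective (R := ℝ) h))
  let m : X → Fin R → ℝ := fun x i => τ x ^ (i : ℕ)
  have h1 : ∀ x y, ∀ᶠ ε : ℝ in 𝓝[≠] 0, 0 < M x y * ((ε • m x + u x) ⬝ᵥ v y) := by
    intro x y
    have hc : Continuous fun ε : ℝ => M x y * ((ε • m x + u x) ⬝ᵥ v y) := by
      simp only [dotProduct, Pi.add_apply, Pi.smul_apply]
      fun_prop
    refine nhdsWithin_le_nhds ?_
    refine hc.continuousAt.eventually_const_lt ?_
    simpa using hsign x y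
  have h2 : ∀ s : Fin R → X, Function.Injective s →
      ∀ᶠ ε : ℝ in 𝓝[≠] 0, (Matrix.of fun i => ε • m (s i) + u (s i)).det ≠ 0 := by
    intro s hs
    set A : Matrix (Fin R) (Fin R) ℝ := Matrix.of fun i => m (s i) with hA
    set B : Matrix (Fin R) (Fin R) ℝ := Matrix.of fun i => u (s i) with hB
    set P : ℝ[X] := det ((Polynomial.X : ℝ[X]) • A.map C + B.map C) with hP
    have hAd : A.det ≠ 0 := by
      have : A = vandermonde fun i => τ (s i) := by
        ext i j
        simp [hA, m, vandermonde_apply]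
      rw [this, det_vandermonde_ne_zero_iff]
      exact hτ.comp hs
    have hP0 : P ≠ 0 := by
      intro h
      apply hAd
      rw [← coeff_det_X_add_C_card A B, ← hP, h, coeff_zero]
    have heval : ∀ ε : ℝ, P.eval ε = (Matrix.of fun i => ε • m (s i) + u (s i)).det := by
      intro ε
      rw [hP, ← coe_evalRingHom, RingHom.map_det]
      congr 1
      ext i j
      simp [hA, hB]
      exact mul_comm _ _
    have hfin : ∀ᶠ ε : ℝ in 𝓝[≠] 0, ¬ P.IsRoot ε := by
      have hf := (finite_setOfPred_isRoot hP0)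
      have h3 : ∀ᶠ ε : ℝ in 𝓝[≠] 0, ε ∈ ({ε | P.IsRoot ε} \ {0})ᶜ :=
        nhdsWithin_le_nhds ((hf.subset Set.sdiff_subset).isClosed.isOpen_compl.mem_nhds (by simp))
      filter_upwards [h3, self_mem_nhdsWithin] with ε h h' hr
      exact h ⟨hr, h'⟩
    filter_upwards [hfin] with ε h
    rwa [← heval]
  have h3 : ∀ᶠ ε : ℝ in 𝓝[≠] 0, (∀ x y, 0 < M x y * ((ε • m x + u x) ⬝ᵥ v y)) ∧
      ∀ s : Fin R → X, Function.Injective s →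
        (Matrix.of fun i => ε • m (s i) + u (s i)).det ≠ 0 :=
    (eventually_all.2 fun x => eventually_all.2 fun y => h1 x y).and
      (eventually_all.2 fun s => by
        by_cases hs : Function.Injective s
        · simpa [hs] using h2 s hs
        · simp [hs])
  obtain ⟨ε, h4, h5⟩ := h3.exists
  exact ⟨fun x => ε • m x + u x, h4, h5⟩

open Matrix in
/-- Forster's lower bound on the rank of sign-representing matrices, in terms of a bound on the
bilinear form of a real matrix with entries bounded away from `0`. -/
theorem forster_rank {X Y : Type*} [Fintype X] [Fintype Y] [Nonempty X] [Nonempty Y]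
    (M : X → Y → ℝ) (A : Matrix X Y ℝ) {γ K : ℝ} (hγ : 0 < γ) (hM : ∀ x y, γ ≤ |M x y|)
    (hsign : ∀ x y, 0 < M x y * A x y) (hR : A.rank < Fintype.card X)
    (hK : ∀ (f : X → ℝ) (g : Y → ℝ),
      (∑ x, ∑ y, M x y * f x * g y) ^ 2 ≤ K * (∑ x, f x ^ 2) * ∑ y, g y ^ 2) :
    γ ^ 2 * (Fintype.card X * Fintype.card Y) ≤ K * A.rank ^ 2 := by
  obtain ⟨u, v, huv⟩ := exists_dotProduct_of_rank A
  simp only [huv] at hsign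
  obtain ⟨u', h1, h2⟩ := exists_general_position M u v hsign
  refine forster_of_general_position M u' v hγ hM h1 ?_ hR h2 hK
  by_contra! h
  have h0 := huv (Classical.arbitrary X) (Classical.arbitrary Y)
  have h3 := hsign (Classical.arbitrary X) (Classical.arbitrary Y)
  have : IsEmpty (Fin A.rank) := by rw [Nat.le_zero.1 h]; infer_instance
  simp [dotProduct] at h3

/-- The sign `±1` attached to a bit. -/
def bsign (t : Bool) : ℝ := if t then -1 else 1

theorem bsign_xor (a b : Bool) : bsign (xor a b) = bsign a * bsign b := by
  cases a <;> cases b <;> simp [bsign]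

theorem bsign_mul_self (a : Bool) : bsign a * bsign a = 1 := by
  cases a <;> simp [bsign]

/-- The Walsh character of the cube attached to a set of coordinates. -/
def walsh {I : Type*} (S : Finset I) (z : I → Bool) : ℝ := ∏ i ∈ S, bsign (z i)

theorem walsh_xor {I : Type*} (S : Finset I) (z w : I → Bool) :
    walsh S (fun i => xor (z i) (w i)) = walsh S z * walsh S w := by
  simp [walsh, bsign_xor, Finset.prod_mul_distrib]

theorem sum_walsh_mul_walsh_index {I : Type*} [Fintype I] [DecidableEq I] (z w : I → Bool) :
    ∑ S : Finset I, walsh S z * walsh S w = if z = w then 2 ^ Fintype.card I else 0 := by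
  have h : ∑ S : Finset I, walsh S z * walsh S w = ∏ i, (1 + bsign (z i) * bsign (w i)) := by
    simp only [Finset.prod_one_add, walsh, ← Finset.prod_mul_distrib, Finset.powerset_univ]
  rw [h]
  split_ifs with hzw
  · subst hzw
    simp only [bsign_mul_self]
    norm_num [Finset.prod_const]
  · obtain ⟨i, hi⟩ := Function.ne_iff.1 hzw
    refine Finset.prod_eq_zero (Finset.mem_univ i) ?_
    cases h1 : z i <;> cases h2 : w i <;> simp_all [bsign]

theorem sum_walsh_mul_walsh {I : Type*} [Fintype I] [DecidableEq I] (S T : Finset I) :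
    ∑ z : I → Bool, walsh S z * walsh T z = if S = T then 2 ^ Fintype.card I else 0 := by
  have h : ∀ z : I → Bool, walsh S z * walsh T z =
      ∏ i, ((if i ∈ S then bsign (z i) else 1) * if i ∈ T then bsign (z i) else 1) := by
    intro z
    rw [Finset.prod_mul_distrib]
    simp [walsh]
  simp only [h]
  rw [← Fintype.prod_sum (f := fun i (t : Bool) =>
    (if i ∈ S then bsign t else 1) * if i ∈ T then bsign t else 1)]
  split_ifs with hST
  · subst hST
    rw [← Finset.card_univ, ← Finset.prod_const]
    refine Finset.prod_congr rfl fun i _ => ?_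
    by_cases hi : i ∈ S <;> simp [hi, bsign] <;> norm_num
  · obtain ⟨i, hi⟩ : ∃ i, ¬ (i ∈ S ↔ i ∈ T) := by
      by_contra! hcon
      exact hST (Finset.ext hcon)
    refine Finset.prod_eq_zero (Finset.mem_univ i) ?_
    by_cases h1 : i ∈ S <;> by_cases h2 : i ∈ T <;> simp_all [bsign]

theorem walsh_parseval {I : Type*} [Fintype I] [DecidableEq I] (h : (I → Bool) → ℝ) :
    ∑ S : Finset I, (∑ w, walsh S w * h w) ^ 2 = 2 ^ Fintype.card I * ∑ w, h w ^ 2 := by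
  have h1 : ∀ S : Finset I, (∑ w, walsh S w * h w) ^ 2 =
      ∑ w, ∑ w', (walsh S w * walsh S w') * (h w * h w') := by
    intro S
    rw [sq, Finset.sum_mul_sum]
    exact Finset.sum_congr rfl fun _ _ => Finset.sum_congr rfl fun _ _ => by ring
  simp only [h1]
  rw [Finset.sum_comm, Finset.mul_sum]
  refine Finset.sum_congr rfl fun w _ => ?_
  rw [Finset.sum_comm]
  simp only [← Finset.sum_mul, sum_walsh_mul_walsh_index]
  simp [sq]

/-- The graph of a selection function over a set of indices. -/
def graphOn {I J : Type*} [DecidableEq I] [DecidableEq J] (S : Finset I) (V : I → J) :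
    Finset (I × J) := S.image fun i => (i, V i)

theorem mem_graphOn {I J : Type*} [DecidableEq I] [DecidableEq J] (S : Finset I) (V : I → J)
    (p : I × J) : p ∈ graphOn S V ↔ p.1 ∈ S ∧ V p.1 = p.2 := by
  constructor
  · intro h
    obtain ⟨i, hi, rfl⟩ := Finset.mem_image.1 h
    exact ⟨hi, rfl⟩
  · rintro ⟨h1, h2⟩
    exact Finset.mem_image.2 ⟨p.1, h1, Prod.ext rfl h2⟩

theorem walsh_graphOn {I J : Type*} [DecidableEq I] [DecidableEq J] (S : Finset I) (V : I → J)
    (x : I × J → Bool) : walsh (graphOn S V) x = walsh S fun i => x (i, V i) := by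
  rw [walsh, graphOn, Finset.prod_image]
  · rfl
  · intro a _ b _ h
    exact congrArg Prod.fst h

theorem card_graphOn_eq_le {I J : Type*} [Fintype I] [DecidableEq I] [Fintype J] [DecidableEq J]
    (S : Finset I) (V : I → J) :
    (Finset.univ.filter fun p : Finset I × (I → J) => graphOn S V = graphOn p.1 p.2).card ≤
      Fintype.card J ^ (Fintype.card I - S.card) := by
  have hS : ∀ p : Finset I × (I → J), graphOn S V = graphOn p.1 p.2 → p.1 = S := by
    intro p hp
    have h : ∀ (S : Finset I) (V : I → J), (graphOn S V).image Prod.fst = S := by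
      intro S V
      rw [graphOn, Finset.image_image]
      exact Finset.image_id
    rw [← h p.1 p.2, ← hp, h]
  refine (Finset.card_le_card_of_injOn (t := Fintype.piFinset fun i =>
    if i ∈ S then {V i} else Finset.univ) Prod.snd ?_ ?_).trans_eq ?_
  · intro p hp
    have hp' : graphOn S V = graphOn p.1 p.2 := by simpa using hp
    rw [Finset.mem_coe, Fintype.mem_piFinset]
    intro i
    split_ifs with hi
    · have h1 : (i, V i) ∈ graphOn S V := (mem_graphOn _ _ _).2 ⟨hi, rfl⟩
      rw [hp', mem_graphOn] at h1
      simpa using h1.2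
    · exact Finset.mem_univ _
  · intro p hp q hq h
    exact Prod.ext ((hS p (by simpa using hp)).trans (hS q (by simpa using hq)).symm) h
  · rw [Fintype.card_piFinset]
    simp only [apply_ite Finset.card, Finset.card_singleton, Finset.card_univ]
    rw [Finset.prod_ite]
    simp [Finset.filter_not, Finset.card_sdiff]

/-- Bound on the bilinear form of a pattern-type matrix by the Walsh coefficients `φ` of the
composed function. -/
theorem pattern_bilinear_bound {I J : Type*} [Fintype I] [DecidableEq I] [Fintype J]
    [DecidableEq J] [Nonempty J] (φ : Finset I → ℝ) (ψ : (I → Bool) → ℝ)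
    (hψ : ∀ z, ψ z = ∑ S, φ S * walsh S z) (d : ℕ) {ε : ℝ}
    (h0 : ∀ S : Finset I, S.card < d → φ S = 0) (hε : ∀ S, |φ S| ≤ ε)
    (f : (I × J → Bool) → ℝ) (g : (I → J) × (I → Bool) → ℝ) :
    (∑ x, ∑ y, ψ (fun i => xor (x (i, y.1 i)) (y.2 i)) * f x * g y) ^ 2 ≤
      (2 ^ Fintype.card (I × J) * Fintype.card J ^ (Fintype.card I - d) * ε ^ 2 *
        2 ^ Fintype.card I) * (∑ x, f x ^ 2) * ∑ y, g y ^ 2 := by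
  set a : Finset I × (I → J) → ℝ := fun p => φ p.1 * ∑ w, walsh p.1 w * g (p.2, w) with ha
  have h1 : ∑ x, ∑ y, ψ (fun i => xor (x (i, y.1 i)) (y.2 i)) * f x * g y =
      ∑ x, f x * ∑ p, a p * walsh (graphOn p.1 p.2) x := by
    refine Finset.sum_congr rfl fun x _ => ?_
    rw [Fintype.sum_prod_type, Fintype.sum_prod_type_right, Finset.mul_sum]
    refine Finset.sum_congr rfl fun V _ => ?_
    simp only [hψ, ha, walsh_xor, walsh_graphOn, Finset.sum_mul, Finset.mul_sum]
    rw [Finset.sum_comm]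
    exact Finset.sum_congr rfl fun S _ => Finset.sum_congr rfl fun w _ => by ring
  rw [h1]
  have h2 : ∑ x, (∑ p, a p * walsh (graphOn p.1 p.2) x) ^ 2 ≤
      2 ^ Fintype.card (I × J) * Fintype.card J ^ (Fintype.card I - d) * ∑ p, a p ^ 2 := by
    have h3 : ∀ x : I × J → Bool, (∑ p, a p * walsh (graphOn p.1 p.2) x) ^ 2 =
        ∑ p : Finset I × (I → J), ∑ q : Finset I × (I → J),
          a p * a q * (walsh (graphOn p.1 p.2) x * walsh (graphOn q.1 q.2) x) := by
      intro x
      rw [sq, Finset.sum_mul_sum]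
      exact Finset.sum_congr rfl fun _ _ => Finset.sum_congr rfl fun _ _ => by ring
    have h4 : ∑ x, (∑ p, a p * walsh (graphOn p.1 p.2) x) ^ 2 = 2 ^ Fintype.card (I × J) *
        ∑ p : Finset I × (I → J), ∑ q : Finset I × (I → J),
          if graphOn p.1 p.2 = graphOn q.1 q.2 then a p * a q else 0 := by
      simp only [h3]
      rw [Finset.sum_comm, Finset.mul_sum]
      refine Finset.sum_congr rfl fun p _ => ?_
      rw [Finset.sum_comm, Finset.mul_sum]
      refine Finset.sum_congr rfl fun q _ => ?_
      rw [← Finset.mul_sum, sum_walsh_mul_walsh]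
      split_ifs <;> ring
    rw [h4, mul_assoc]
    refine mul_le_mul_of_nonneg_left ?_ (by positivity)
    have h5 : ∑ p : Finset I × (I → J), ∑ q : Finset I × (I → J),
          (if graphOn p.1 p.2 = graphOn q.1 q.2 then a p * a q else 0) ≤
        ∑ p : Finset I × (I → J), ∑ q : Finset I × (I → J),
          (if graphOn p.1 p.2 = graphOn q.1 q.2 then a p ^ 2 else 0) := by
      have h6 : ∑ p : Finset I × (I → J), ∑ q : Finset I × (I → J),
            (if graphOn p.1 p.2 = graphOn q.1 q.2 then a q ^ 2 else 0) =
          ∑ p : Finset I × (I → J), ∑ q : Finset I × (I → J),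
            (if graphOn p.1 p.2 = graphOn q.1 q.2 then a p ^ 2 else 0) := by
        rw [Finset.sum_comm]
        simp only [eq_comm]
      have h7 : 2 * ∑ p : Finset I × (I → J), ∑ q : Finset I × (I → J),
            (if graphOn p.1 p.2 = graphOn q.1 q.2 then a p * a q else 0) ≤
          ∑ p : Finset I × (I → J), ∑ q : Finset I × (I → J),
            (if graphOn p.1 p.2 = graphOn q.1 q.2 then a p ^ 2 else 0) +
          ∑ p : Finset I × (I → J), ∑ q : Finset I × (I → J),
            (if graphOn p.1 p.2 = graphOn q.1 q.2 then a q ^ 2 else 0) := by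
        simp only [Finset.mul_sum, ← Finset.sum_add_distrib]
        refine Finset.sum_le_sum fun p _ => Finset.sum_le_sum fun q _ => ?_
        split_ifs
        · nlinarith [sq_nonneg (a p - a q)]
        · simp
      linarith
    refine h5.trans ?_
    rw [Finset.mul_sum]
    refine Finset.sum_le_sum fun p _ => ?_
    rw [← Finset.sum_filter, Finset.sum_const, nsmul_eq_mul]
    by_cases hp : p.1.card < d
    · simp [ha, h0 _ hp]
    refine mul_le_mul_of_nonneg_right ?_ (sq_nonneg _)
    have h8 := card_graphOn_eq_le p.1 p.2
    have h9 : Fintype.card J ^ (Fintype.card I - p.1.card) ≤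
        Fintype.card J ^ (Fintype.card I - d) :=
      Nat.pow_le_pow_right Fintype.card_pos (by omega)
    exact_mod_cast h8.trans h9
  have h3 : ∑ p, a p ^ 2 ≤ ε ^ 2 * (2 ^ Fintype.card I * ∑ y, g y ^ 2) := by
    rw [Fintype.sum_prod_type_right, Fintype.sum_prod_type, Finset.mul_sum, Finset.mul_sum]
    refine Finset.sum_le_sum fun V _ => ?_
    rw [← walsh_parseval, Finset.mul_sum]
    refine Finset.sum_le_sum fun S _ => ?_
    simp only [ha, mul_pow]
    refine mul_le_mul_of_nonneg_right ?_ (sq_nonneg _)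
    rw [← sq_abs]
    exact pow_le_pow_left₀ (abs_nonneg _) (hε S) 2
  calc _ ≤ (∑ x, f x ^ 2) * ∑ x, (∑ p, a p * walsh (graphOn p.1 p.2) x) ^ 2 :=
        Finset.sum_mul_sq_le_sq_mul_sq _ _ _
    _ ≤ (∑ x, f x ^ 2) * (2 ^ Fintype.card (I × J) * Fintype.card J ^ (Fintype.card I - d) *
          (ε ^ 2 * (2 ^ Fintype.card I * ∑ y, g y ^ 2))) := by
        refine mul_le_mul_of_nonneg_left (h2.trans ?_) (Finset.sum_nonneg fun _ _ => sq_nonneg _)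
        exact mul_le_mul_of_nonneg_left h3 (by positivity)
    _ = _ := by ring

/-- Number of ones of a Boolean vector over an arbitrary finite index type. -/
def boolWeight {I : Type*} [Fintype I] (z : I → Bool) : ℕ :=
  (Finset.univ.filter fun i => z i = true).card

theorem boolWeight_le {I : Type*} [Fintype I] (z : I → Bool) :
    boolWeight z ≤ Fintype.card I := Finset.card_le_univ _

theorem card_boolWeight_eq_of_subset {I : Type*} [Fintype I] [DecidableEq I] (U : Finset I)
    (j : ℕ) (hj : U.card ≤ j) :
    (Finset.univ.filter fun z : I → Bool => boolWeight z = j ∧ ∀ i ∈ U, z i = true).card =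
      (Fintype.card I - U.card).choose (j - U.card) := by
  rw [← Finset.card_compl, ← Finset.card_powersetCard]
  refine Finset.card_nbij' (fun z => (Finset.univ.filter fun i => z i = true) \ U)
    (fun T i => decide (i ∈ T ∪ U)) ?_ ?_ ?_ ?_
  · intro z hz
    simp only [Finset.coe_filter, Finset.mem_univ, true_and] at hz
    obtain ⟨h1, h2⟩ := hz
    simp only [Finset.mem_coe, Finset.mem_powersetCard]
    refine ⟨fun i hi => by simp_all, ?_⟩
    rw [Finset.card_sdiff_of_subset (fun i hi => by simp [h2 i hi])]
    rw [← h1, boolWeight]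
  · intro T hT
    simp only [Finset.mem_coe, Finset.mem_powersetCard] at hT
    refine Finset.mem_coe.2 (Finset.mem_filter.2 ⟨Finset.mem_univ _, ?_, fun i hi => by simp [hi]⟩)
    rw [boolWeight]
    have : (Finset.univ.filter fun i => decide (i ∈ T ∪ U) = true) = T ∪ U := by
      ext i; simp
    rw [this, Finset.card_union_of_disjoint (Finset.disjoint_left.2 fun i hi hU => by
      simpa [hU] using hT.1 hi), hT.2]
    omega
  · intro z hz
    simp only [Finset.mem_coe, Finset.mem_filter, Finset.mem_univ, true_and] at hz
    funext i
    by_cases hi : i ∈ U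
    · simp [hi, hz.2 i hi]
    · simp [hi]
  · intro T hT
    simp only [Finset.mem_coe, Finset.mem_powersetCard] at hT
    ext i
    have := @hT.1 i
    simp only [Finset.mem_compl] at this
    simp
    tauto

open Polynomial in
/-- The average of a Walsh character over the vectors of weight `j` is a polynomial in `j`. -/
theorem exists_polynomial_sum_walsh {I : Type*} [Fintype I] [DecidableEq I] (S : Finset I) :
    ∃ p : ℝ[X], p.natDegree ≤ S.card ∧ ∀ j ≤ Fintype.card I,
      ∑ z : I → Bool with boolWeight z = j, walsh S z =
        (Fintype.card I).choose j * p.eval (j : ℝ) := by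
  set B := Fintype.card I with hB
  refine ⟨∑ U ∈ S.powerset, C ((-2 : ℝ) ^ U.card / (B.choose U.card * U.card.factorial)) *
    descPochhammer ℝ U.card, ?_, fun j hj => ?_⟩
  · refine natDegree_sum_le_of_forall_le _ _ fun U hU => ?_
    refine (natDegree_C_mul_le _ _).trans ?_
    rw [descPochhammer_natDegree]
    exact Finset.card_le_card (Finset.mem_powerset.1 hU)
  · have h1 : ∀ z : I → Bool, walsh S z =
        ∑ U ∈ S.powerset, (-2) ^ U.card * if ∀ i ∈ U, z i = true then 1 else 0 := by
      intro z
      have : ∀ i, bsign (z i) = 1 + (-2) * if z i = true then 1 else 0 := by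
        intro i
        cases z i <;> simp [bsign] <;> norm_num
      simp only [walsh, this, Finset.prod_one_add]
      refine Finset.sum_congr rfl fun U _ => ?_
      rw [Finset.prod_mul_distrib, Finset.prod_const, Finset.prod_boole]
      congr
    simp only [h1]
    rw [Finset.sum_comm, eval_finsetSum, Finset.mul_sum]
    refine Finset.sum_congr rfl fun U _ => ?_
    rw [← Finset.mul_sum, ← Finset.sum_filter, Finset.filter_filter, Finset.sum_const,
      nsmul_eq_mul, mul_one, eval_mul, eval_C, descPochhammer_eval_eq_descFactorial]
    have hUB : U.card ≤ B := Finset.card_le_univ U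
    have hc0 : (B.choose U.card : ℝ) ≠ 0 := by exact_mod_cast (Nat.choose_pos hUB).ne'
    have hf0 : (U.card.factorial : ℝ) ≠ 0 := by exact_mod_cast U.card.factorial_ne_zero
    rw [Nat.descFactorial_eq_factorial_mul_choose]
    by_cases hUj : U.card ≤ j
    · rw [card_boolWeight_eq_of_subset U j hUj, ← hB]
      have h2 := Nat.choose_mul (n := B) hUj
      have h3 : (B.choose j : ℝ) * j.choose U.card =
          B.choose U.card * (B - U.card).choose (j - U.card) := by exact_mod_cast h2
      push_cast
      field_simp
      linear_combination -h3
    · have h2 : (Finset.univ.filter fun z : I → Bool => boolWeight z = j ∧ ∀ i ∈ U, z i = true) =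
          ∅ := by
        rw [Finset.filter_eq_empty_iff]
        rintro z - ⟨h3, h4⟩
        apply hUj
        rw [← h3]
        exact Finset.card_le_card fun i hi => by simp [h4 i hi]
      rw [h2, Nat.choose_eq_zero_of_lt (not_le.1 hUj)]
      simp

open Polynomial in
/-- Lower bound on the rank of a matrix sign-representing `w |z|` composed with the selection
gadget, where the weights `w` annihilate all polynomials of degree less than `d`. -/
theorem pattern_rank_bound {I J : Type*} [Fintype I] [DecidableEq I] [Fintype J]
    [DecidableEq J] [Nonempty J] (w : ℕ → ℝ) (d : ℕ) (W : ℝ) (hd : d ≤ Fintype.card I)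
    (hann : ∀ p : ℝ[X], p.degree < d →
      ∑ j ∈ Finset.range (Fintype.card I + 1), w j * p.eval (j : ℝ) = 0)
    (hw1 : ∀ j ≤ Fintype.card I, 1 ≤ |w j|)
    (hW : ∑ j ∈ Finset.range (Fintype.card I + 1), |w j| ≤ W)
    (A : Matrix (I × J → Bool) ((I → J) × (I → Bool)) ℝ)
    (hA : ∀ x y, 0 < w (boolWeight fun i => xor (x (i, y.1 i)) (y.2 i)) * A x y)
    (hR : A.rank < 2 ^ Fintype.card (I × J)) :
    (Fintype.card J : ℝ) ^ d ≤ W ^ 2 * A.rank ^ 2 := by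
  set B := Fintype.card I with hB
  set ψ : (I → Bool) → ℝ := fun z => w (boolWeight z) / B.choose (boolWeight z) with hψ
  set φ : Finset I → ℝ := fun S => (∑ z, ψ z * walsh S z) / 2 ^ B with hφ
  have hinv : ∀ z, ψ z = ∑ S, φ S * walsh S z := by
    intro z
    have h1 : ∀ S, φ S * walsh S z = ∑ z', ψ z' / 2 ^ B * (walsh S z' * walsh S z) := by
      intro S
      simp only [hφ, Finset.sum_div, Finset.sum_mul]
      exact Finset.sum_congr rfl fun _ _ => by ring
    simp only [h1]
    rw [Finset.sum_comm]
    simp only [← Finset.mul_sum, sum_walsh_mul_walsh_index]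
    simp [← hB]
  have hch : ∀ j ≤ B, (0 : ℝ) < B.choose j := fun j hj => by exact_mod_cast Nat.choose_pos hj
  have hmaps : ∀ z ∈ (Finset.univ : Finset (I → Bool)), boolWeight z ∈ Finset.range (B + 1) :=
    fun z _ => Finset.mem_range.2 (Nat.lt_succ_of_le (boolWeight_le z))
  have hφ0 : ∀ S : Finset I, S.card < d → φ S = 0 := by
    intro S hS
    obtain ⟨p, hp, hpe⟩ := exists_polynomial_sum_walsh S
    have h1 := hann p ((degree_le_of_natDegree_le hp).trans_lt (by exact_mod_cast hS))
    simp only [hφ]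
    rw [div_eq_zero_iff]
    left
    rw [← Finset.sum_fiberwise_of_maps_to hmaps, ← h1]
    refine Finset.sum_congr rfl fun j hj => ?_
    have hj' : j ≤ B := Nat.lt_succ_iff.1 (Finset.mem_range.1 hj)
    have h2 : ∑ z with boolWeight z = j, ψ z * walsh S z =
        w j / B.choose j * ∑ z : I → Bool with boolWeight z = j, walsh S z := by
      rw [Finset.mul_sum]
      refine Finset.sum_congr rfl fun z hz => ?_
      rw [hψ]
      simp only [(Finset.mem_filter.1 hz).2]
    rw [h2, hpe j hj', ← hB]
    have := (hch j hj').ne'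
    field_simp
  have hsumψ : ∑ z, |ψ z| ≤ W := by
    refine le_trans (le_of_eq ?_) hW
    rw [← Finset.sum_fiberwise_of_maps_to hmaps]
    refine Finset.sum_congr rfl fun j hj => ?_
    have hj' : j ≤ B := Nat.lt_succ_iff.1 (Finset.mem_range.1 hj)
    have h2 : ∑ z with boolWeight z = j, |ψ z| =
        ∑ z : I → Bool with boolWeight z = j, |w j| / B.choose j := by
      refine Finset.sum_congr rfl fun z hz => ?_
      rw [hψ]
      simp only [(Finset.mem_filter.1 hz).2, abs_div, Nat.abs_cast]
    have h3 := card_boolWeight_eq_of_subset (∅ : Finset I) j (by simp)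
    simp only [Finset.notMem_empty, false_imp_iff, implies_true, and_true, Finset.card_empty,
      Nat.sub_zero] at h3
    rw [h2, Finset.sum_const, h3, nsmul_eq_mul]
    have := (hch j hj').ne'
    rw [← hB]
    field_simp
  have hφε : ∀ S, |φ S| ≤ W / 2 ^ B := by
    intro S
    simp only [hφ]
    rw [abs_div, abs_of_pos (by positivity : (0 : ℝ) < 2 ^ B)]
    refine div_le_div_of_nonneg_right ?_ (by positivity)
    refine (Finset.abs_sum_le_sum_abs _ _).trans (le_trans (le_of_eq ?_) hsumψ)
    refine Finset.sum_congr rfl fun z _ => ?_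
    have : |walsh S z| = 1 := by
      rw [walsh, Finset.abs_prod]
      refine Finset.prod_eq_one fun i _ => ?_
      cases z i <;> simp [bsign]
    rw [abs_mul, this, mul_one]
  have hψγ : ∀ z, ((2 : ℝ) ^ B)⁻¹ ≤ |ψ z| := by
    intro z
    have h1 := hch _ (boolWeight_le z)
    rw [hψ]
    simp only [abs_div, Nat.abs_cast]
    rw [inv_eq_one_div, div_le_div_iff₀ (by positivity) h1, one_mul]
    have h2 : (B.choose (boolWeight z) : ℝ) ≤ 2 ^ B := by
      exact_mod_cast Nat.choose_le_two_pow _ _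
    nlinarith [hw1 _ (boolWeight_le z)]
  have key := forster_rank (γ := ((2 : ℝ) ^ B)⁻¹)
    (fun x (y : (I → J) × (I → Bool)) => ψ fun i => xor (x (i, y.1 i)) (y.2 i)) A (by positivity)
    (fun x y => hψγ _) (fun x y => ?_) (by simpa using hR)
    (fun f g => pattern_bilinear_bound φ ψ hinv d hφ0 hφε f g)
  · have hJ : (0 : ℝ) < Fintype.card J := by exact_mod_cast Fintype.card_pos
    simp only [Fintype.card_fun, Fintype.card_prod, Fintype.card_bool, ← hB] at key
    have hsplit : (Fintype.card J : ℝ) ^ B = Fintype.card J ^ (B - d) * Fintype.card J ^ d := by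
      rw [← pow_add]; congr 1; omega
    push_cast at key
    rw [hsplit] at key
    set a : ℝ := 2 ^ B
    have ha : 0 < a := by positivity
    set e : ℝ := 2 ^ (B * Fintype.card J)
    have he : 0 < e := by positivity
    set q : ℝ := (Fintype.card J : ℝ) ^ (B - d)
    have hq : 0 < q := by positivity
    field_simp at key
    nlinarith
  · rw [hψ]
    simp only
    rw [div_mul_eq_mul_div]
    exact div_pos (hA x y) (hch _ (boolWeight_le _))

theorem prod_sub_eq_neg_one_pow_mul (s : Finset ℕ) (p : ℕ → ℕ) (hp : StrictMonoOn p s) {f : ℕ}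
    (hf : f ∈ s) :
    ∏ i ∈ s.erase f, ((p f : ℝ) - p i) =
      (-1) ^ (s.filter (f < ·)).card * ∏ i ∈ s.erase f, |(p f : ℝ) - p i| := by
  have h1 : ∀ i ∈ s.erase f, (p f : ℝ) - p i =
      (if f < i then -1 else 1) * |(p f : ℝ) - p i| := by
    intro i hi
    obtain ⟨hne, his⟩ := Finset.mem_erase.1 hi
    rcases lt_or_gt_of_ne hne with h | h
    · have : (p i : ℝ) < p f := by exact_mod_cast hp his hf h
      rw [if_neg (by omega), abs_of_pos (by linarith), one_mul]
    · have : (p f : ℝ) < p i := by exact_mod_cast hp hf his h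
      rw [if_pos h, abs_of_neg (by linarith)]
      ring
  rw [Finset.prod_congr rfl h1, Finset.prod_mul_distrib, Finset.prod_ite, Finset.prod_const_one,
    mul_one, Finset.prod_const]
  congr 3
  ext i
  simp only [Finset.mem_filter, Finset.mem_erase]
  constructor
  · rintro ⟨⟨-, h⟩, h'⟩; exact ⟨h, h'⟩
  · rintro ⟨h, h'⟩; exact ⟨⟨by omega, h⟩, h'⟩

open Polynomial in
/-- Alternating divided-difference weights annihilate polynomials of small degree. -/
theorem sum_alternating_weights_eq_zero (s : Finset ℕ) (p : ℕ → ℕ) (hp : StrictMonoOn p s)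
    (P : ℝ[X]) (hP : P.degree < (s.card - 1 : ℕ)) :
    ∑ f ∈ s, (-1) ^ (s.filter (· < f)).card / (∏ i ∈ s.erase f, |(p f : ℝ) - p i|) *
      P.eval (p f : ℝ) = 0 := by
  have hinj : Set.InjOn (fun f => (p f : ℝ)) s := fun a ha b hb h =>
    hp.injOn ha hb (Nat.cast_injective (R := ℝ) h)
  have h1 := Lagrange.coeff_eq_sum hinj (P := P)
    (hP.trans_le (by exact_mod_cast Nat.sub_le _ _))
  rw [coeff_eq_zero_of_degree_lt hP] at h1
  rw [← mul_zero ((-1 : ℝ) ^ (s.card - 1)), h1, Finset.mul_sum]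
  refine Finset.sum_congr rfl fun f hf => ?_
  rw [prod_sub_eq_neg_one_pow_mul s p hp hf]
  have hcard : s.card - 1 = (s.filter (· < f)).card + (s.filter (f < ·)).card := by
    have h2 : s = (s.filter (· < f) ∪ s.filter (f < ·)) ∪ {f} := by
      ext i
      simp only [Finset.mem_union, Finset.mem_filter, Finset.mem_singleton]
      constructor
      · intro h; rcases lt_trichotomy i f with h' | h' | h' <;> simp [h, h']
      · rintro ((h | h) | rfl)
        · exact h.1
        · exact h.1
        · exact hf
    have h3 : Disjoint (s.filter (· < f)) (s.filter (f < ·)) :=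
      Finset.disjoint_left.2 fun i h h' => by
        simp only [Finset.mem_filter] at h h'; omega
    have h4 : Disjoint (s.filter (· < f) ∪ s.filter (f < ·)) {f} :=
      Finset.disjoint_left.2 fun i h h' => by
        simp only [Finset.mem_union, Finset.mem_filter, Finset.mem_singleton] at h h'; omega
    have h5 := congrArg Finset.card h2
    rw [Finset.card_union_of_disjoint h4, Finset.card_union_of_disjoint h3,
      Finset.card_singleton] at h5
    omega
  rw [hcard, pow_add]
  have h6 : ((-1 : ℝ) ^ (s.filter (f < ·)).card) ^ 2 = 1 := by
    rw [← pow_mul, mul_comm, pow_mul]; simp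
  have h7 : ((-1 : ℝ) ^ (s.filter (f < ·)).card) ≠ 0 := pow_ne_zero _ (by norm_num)
  have h8 : ∏ i ∈ s.erase f, |(p f : ℝ) - p i| ≠ 0 := by
    refine Finset.prod_ne_zero_iff.2 fun i hi => abs_ne_zero.2 (sub_ne_zero.2 fun h => ?_)
    exact (Finset.mem_erase.1 hi).1 (hinj (Finset.mem_erase.1 hi).2 hf h.symm)
  field_simp

theorem pow_card_le_pow_mul_prod {s : Finset ℕ} {d : ℕ → ℝ} {Q : ℝ} (hQ : 1 ≤ Q) {k : ℕ}
    (hd : ∀ i ∈ s, 1 ≤ d i) (hk : (s.filter (d · < Q)).card ≤ k) :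
    Q ^ s.card ≤ Q ^ k * ∏ i ∈ s, d i := by
  have h1 : ∏ i ∈ s, Q ≤ ∏ i ∈ s, ((if d i < Q then Q else 1) * d i) := by
    refine Finset.prod_le_prod (fun _ _ => by linarith) fun i hi => ?_
    split_ifs with h
    · nlinarith [hd i hi]
    · linarith
  rw [Finset.prod_const, Finset.prod_mul_distrib, Finset.prod_ite, Finset.prod_const_one, mul_one,
    Finset.prod_const] at h1
  refine h1.trans (mul_le_mul_of_nonneg_right (pow_le_pow_right₀ hQ hk) ?_)
  exact Finset.prod_nonneg fun i hi => by linarith [hd i hi]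

open Polynomial in
/-- Weights on the nodes near the sign changes of `G`, agreeing in sign with `G`, with a
prescribed unit weight at `j`. -/
theorem exists_node_weights (N Q r : ℕ) (hN : 0 < N) (hQ : 0 < Q) (G : ℕ → ℝ)
    (hG : ∀ t ≤ N * Q, G t = 1 ∨ G t = -1) (H : Finset ℕ) (hHB : ∀ t ∈ H, t < N * Q)
    (hH : ∀ t ∈ H, G t ≠ G (t + 1)) (hr : ∀ a, (H.filter (· / Q = a)).card ≤ r)
    (j : ℕ) (hj : j ≤ N * Q) :
    ∃ w : ℕ → ℝ, w j = G j ∧ (∀ i ≤ N * Q, 0 ≤ w i * G i) ∧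
      (∀ P : ℝ[X], P.degree < (H.card - 2 : ℕ) →
        ∑ i ∈ Finset.range (N * Q + 1), w i * P.eval (i : ℝ) = 0) ∧
      ∀ i, |w i| ≤ (N : ℝ) ^ H.card * Q ^ (3 * r + 1) := by
  set H₀ := H.filter fun t => t ≠ j ∧ t + 1 ≠ j with hH₀
  set s := insert j H₀ with hs
  have hjH₀ : j ∉ H₀ := by simp [hH₀]
  have hjs : j ∈ s := Finset.mem_insert_self _ _
  have hscard : s.card = H₀.card + 1 := Finset.card_insert_of_notMem hjH₀
  have hH₀le : H₀.card ≤ H.card := Finset.card_filter_le _ _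
  have hH₀ge : H.card - 2 ≤ H₀.card := by
    have h1 : H ⊆ H₀ ∪ {j, j - 1} := by
      intro t ht
      by_cases h : t ≠ j ∧ t + 1 ≠ j
      · exact Finset.mem_union_left _ (Finset.mem_filter.2 ⟨ht, h⟩)
      · refine Finset.mem_union_right _ ?_
        simp only [Finset.mem_insert, Finset.mem_singleton]
        omega
    have h2 := (Finset.card_le_card h1).trans (Finset.card_union_le _ _)
    have h3 := Finset.card_le_two (a := j) (b := j - 1)
    omega
  set rk : ℕ → ℕ := fun f => (s.filter (· < f)).card with hrk
  set σ : ℕ → ℝ := fun f => G j * (-1) ^ (rk j + rk f) with hσ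
  have hGj := hG j hj
  have hpm : ∀ k : ℕ, (-1 : ℝ) ^ k = 1 ∨ (-1 : ℝ) ^ k = -1 := neg_one_pow_eq_or ℝ
  have hσpm : ∀ f, σ f = 1 ∨ σ f = -1 := by
    intro f
    simp only [hσ]
    rcases hGj with h | h <;> rcases hpm (rk j + rk f) with h' | h' <;> simp [h, h']
  have hσsucc : ∀ f ∈ s, f + 1 ∈ s → σ (f + 1) = - σ f := by
    intro f hf _
    have : rk (f + 1) = rk f + 1 := by
      simp only [hrk]
      rw [← Finset.card_insert_of_notMem (a := f) (s := s.filter (· < f)) (by simp)]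
      congr 1
      ext i
      simp only [Finset.mem_filter, Finset.mem_insert]
      constructor
      · rintro ⟨h1, h2⟩
        by_cases h : i = f
        · exact Or.inl h
        · exact Or.inr ⟨h1, by omega⟩
      · rintro (rfl | ⟨h1, h2⟩)
        · exact ⟨hf, by omega⟩
        · exact ⟨h1, by omega⟩
    simp only [hσ, this]
    ring
  classical
  set p : ℕ → ℕ := fun f => if f = j then j else if G f = σ f then f else f + 1 with hp
  have hpj : p j = j := by simp [hp]
  have hp_or : ∀ f, p f = f ∨ p f = f + 1 := by
    intro f
    simp only [hp]
    split_ifs with h1 h2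
    · exact Or.inl h1.symm
    · exact Or.inl rfl
    · exact Or.inr rfl
  have hsmem : ∀ f ∈ s, f ≠ j → f ∈ H ∧ f + 1 ≠ j := by
    intro f hf hfj
    rcases Finset.mem_insert.1 hf with h | h
    · exact absurd h hfj
    · exact ⟨(Finset.mem_filter.1 h).1, (Finset.mem_filter.1 h).2.2⟩
  have hpB : ∀ f ∈ s, p f ≤ N * Q := by
    intro f hf
    by_cases hfj : f = j
    · rw [hfj, hpj]; exact hj
    · have := hHB f (hsmem f hf hfj).1
      rcases hp_or f with h | h <;> omega
  have hGp : ∀ f ∈ s, G (p f) = σ f := by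
    intro f hf
    by_cases hfj : f = j
    · subst hfj
      rw [hpj]
      simp [hσ, ← two_mul, pow_mul]
    · simp only [hp, if_neg hfj]
      split_ifs with h
      · exact h
      · have h1 := hH f (hsmem f hf hfj).1
        have h2 := hHB f (hsmem f hf hfj).1
        rcases hG f h2.le with h3 | h3 <;> rcases hG (f + 1) h2 with h4 | h4 <;>
          rcases hσpm f with h5 | h5 <;>
          first
          | exact absurd (h3.trans h5.symm) h
          | exact absurd (h3.trans h4.symm) h1
          | exact h4.trans h5.symm
  have hpmono : StrictMonoOn p s := by
    intro f hf g hg hfg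
    have hle : p f ≤ p g := by
      rcases hp_or f with h1 | h1 <;> rcases hp_or g with h2 | h2 <;> omega
    refine lt_of_le_of_ne hle fun heq => ?_
    have hg1 : g = f + 1 := by
      rcases hp_or f with h1 | h1 <;> rcases hp_or g with h2 | h2 <;> omega
    subst hg1
    have h1 := hGp f hf
    have h2 := hGp _ hg
    rw [← heq, h1, hσsucc f hf hg] at h2
    rcases hσpm f with h3 | h3 <;> rw [h3] at h2 <;> norm_num at h2
  set Δ : ℕ → ℝ := fun f => ∏ i ∈ s.erase f, |(p f : ℝ) - p i| with hΔ
  have hone : ∀ f ∈ s, ∀ i ∈ s.erase f, 1 ≤ |(p f : ℝ) - p i| := by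
    intro f hf i hi
    have h1 : (p f : ℤ) - p i ≠ 0 := by
      intro h
      exact (Finset.mem_erase.1 hi).1
        (hpmono.injOn (Finset.mem_erase.1 hi).2 hf (by omega))
    exact_mod_cast Int.one_le_abs h1
  have hΔpos : ∀ f ∈ s, 0 < Δ f := fun f hf =>
    Finset.prod_pos fun i hi => lt_of_lt_of_le one_pos (hone f hf i hi)
  have hN1 : (1 : ℝ) ≤ N := by exact_mod_cast hN
  have hQ1 : (1 : ℝ) ≤ Q := by exact_mod_cast hQ
  have hΔj : Δ j ≤ (N : ℝ) ^ H.card * Q ^ H₀.card := by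
    calc Δ j ≤ ∏ i ∈ s.erase j, ((N : ℝ) * Q) := by
          refine Finset.prod_le_prod (fun _ _ => abs_nonneg _) fun i hi => ?_
          have h1 : (p j : ℝ) ≤ N * Q := by exact_mod_cast hpB j hjs
          have h2 : (p i : ℝ) ≤ N * Q := by exact_mod_cast hpB i (Finset.mem_erase.1 hi).2
          have h3 : (0 : ℝ) ≤ p i := Nat.cast_nonneg _
          have h4 : (0 : ℝ) ≤ p j := Nat.cast_nonneg _
          exact abs_le.2 ⟨by linarith, by linarith⟩
      _ = (N : ℝ) ^ H₀.card * Q ^ H₀.card := by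
          rw [Finset.prod_const, Finset.card_erase_of_mem hjs, hscard, Nat.add_sub_cancel, mul_pow]
      _ ≤ _ := mul_le_mul_of_nonneg_right (pow_le_pow_right₀ hN1 hH₀le) (by positivity)
  have hΔlow : ∀ f ∈ s, (Q : ℝ) ^ H₀.card ≤ Q ^ (3 * r + 1) * Δ f := by
    intro f hf
    have hc : (s.erase f).card = H₀.card := by
      rw [Finset.card_erase_of_mem hf, hscard, Nat.add_sub_cancel]
    rw [← hc]
    refine pow_card_le_pow_mul_prod hQ1 (hone f hf) ?_
    set a := p f / Q with ha
    have hsub : ((s.erase f).filter fun i => |(p f : ℝ) - p i| < Q) ⊆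
        insert j (H.filter (· / Q = a - 1) ∪ H.filter (· / Q = a) ∪ H.filter (· / Q = a + 1)) := by
      intro i hi
      obtain ⟨h1, h2⟩ := Finset.mem_filter.1 hi
      by_cases hij : i = j
      · rw [hij]; exact Finset.mem_insert_self _ _
      have hiH := (hsmem i (Finset.mem_erase.1 h1).2 hij).1
      refine Finset.mem_insert_of_mem ?_
      have h3 : |(p f : ℤ) - p i| < Q := by exact_mod_cast h2
      obtain ⟨h4, h5⟩ := abs_lt.1 h3
      have h6 : i ≤ p i ∧ p i ≤ i + 1 := by rcases hp_or i with h | h <;> omega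
      have h7 : i < p f + Q := by omega
      have h8 : p f ≤ i + Q := by omega
      have h9 : i / Q ≤ a + 1 := by
        rw [ha, ← Nat.add_div_right _ hQ]; exact Nat.div_le_div_right h7.le
      have h10 : a ≤ i / Q + 1 := by
        rw [ha, ← Nat.add_div_right _ hQ]; exact Nat.div_le_div_right h8
      simp only [Finset.mem_union, Finset.mem_filter, hiH, true_and]
      clear_value a
      generalize i / Q = e at h9 h10 ⊢
      omega
    refine (Finset.card_le_card hsub).trans ((Finset.card_insert_le _ _).trans ?_)
    have h1 := hr (a - 1)
    have h2 := hr a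
    have h3 := hr (a + 1)
    have h4 := Finset.card_union_le (H.filter (· / Q = a - 1) ∪ H.filter (· / Q = a))
      (H.filter (· / Q = a + 1))
    have h5 := Finset.card_union_le (H.filter (· / Q = a - 1)) (H.filter (· / Q = a))
    omega
  set w : ℕ → ℝ := fun i => ∑ f ∈ s, if p f = i then σ f * (Δ j / Δ f) else 0 with hw
  have hwp : ∀ f ∈ s, w (p f) = σ f * (Δ j / Δ f) := by
    intro f hf
    simp only [hw]
    rw [Finset.sum_eq_single f]
    · simp
    · intro g hg hgf
      rw [if_neg fun h => hgf (hpmono.injOn hg hf h)]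
    · exact fun h => absurd hf h
  have hw0 : ∀ i, (∀ f ∈ s, p f ≠ i) → w i = 0 := fun i hi =>
    Finset.sum_eq_zero fun f hf => if_neg (hi f hf)
  refine ⟨w, ?_, ?_, ?_, ?_⟩
  · have h1 := hwp j hjs
    rw [hpj, div_self (hΔpos j hjs).ne', mul_one, ← hGp j hjs, hpj] at h1
    exact h1
  · intro i hi
    by_cases h : ∃ f ∈ s, p f = i
    · obtain ⟨f, hf, rfl⟩ := h
      rw [hwp f hf, hGp f hf]
      have h1 := div_pos (hΔpos j hjs) (hΔpos f hf)
      rcases hσpm f with h2 | h2 <;> rw [h2] <;> nlinarith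
    · push Not at h
      rw [hw0 i h, zero_mul]
  · intro P hP
    have h1 := sum_alternating_weights_eq_zero s p hpmono P
      (hP.trans_le (by rw [hscard, Nat.add_sub_cancel]; exact_mod_cast hH₀ge))
    have h2 : ∑ i ∈ Finset.range (N * Q + 1), w i * P.eval (i : ℝ) =
        ∑ f ∈ s, σ f * (Δ j / Δ f) * P.eval (p f : ℝ) := by
      simp only [hw, Finset.sum_mul]
      rw [Finset.sum_comm]
      refine Finset.sum_congr rfl fun f hf => ?_
      rw [Finset.sum_eq_single (p f)]
      · simp
      · intro i _ hi
        rw [if_neg hi.symm, zero_mul]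
      · intro h
        exact absurd (Finset.mem_range.2 (Nat.lt_succ_of_le (hpB f hf))) h
    rw [h2, ← mul_zero (G j * (-1) ^ rk j * Δ j), ← h1, Finset.mul_sum]
    refine Finset.sum_congr rfl fun f hf => ?_
    simp only [hσ, hrk, hΔ, pow_add]
    ring
  · intro i
    by_cases h : ∃ f ∈ s, p f = i
    · obtain ⟨f, hf, rfl⟩ := h
      have h1 : |σ f| = 1 := by rcases hσpm f with h2 | h2 <;> rw [h2] <;> norm_num
      rw [hwp f hf, abs_mul, h1, one_mul, abs_of_pos (div_pos (hΔpos j hjs) (hΔpos f hf)),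
        div_le_iff₀ (hΔpos f hf), mul_assoc]
      exact hΔj.trans (mul_le_mul_of_nonneg_left (hΔlow f hf) (by positivity))
    · push Not at h
      rw [hw0 i h, abs_zero]
      positivity

open Polynomial in
/-- Weights with the sign pattern of `G`, all of absolute value at least one, of moderate total
mass, and annihilating polynomials of degree less than the number of selected sign changes. -/
theorem exists_annihilating_weights (N Q r : ℕ) (hN : 0 < N) (hQ : 0 < Q) (G : ℕ → ℝ)
    (hG : ∀ t ≤ N * Q, G t = 1 ∨ G t = -1) (H : Finset ℕ) (hHB : ∀ t ∈ H, t < N * Q)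
    (hH : ∀ t ∈ H, G t ≠ G (t + 1)) (hr : ∀ a, (H.filter (· / Q = a)).card ≤ r) :
    ∃ w : ℕ → ℝ, (∀ i ≤ N * Q, 1 ≤ w i * G i) ∧
      (∀ P : ℝ[X], P.degree < (H.card - 2 : ℕ) →
        ∑ i ∈ Finset.range (N * Q + 1), w i * P.eval (i : ℝ) = 0) ∧
      ∑ i ∈ Finset.range (N * Q + 1), |w i| ≤
        ((N * Q + 1 : ℕ) : ℝ) ^ 2 * ((N : ℝ) ^ H.card * Q ^ (3 * r + 1)) := by
  have hex := fun j : Finset.range (N * Q + 1) => exists_node_weights N Q r hN hQ G hG H hHB hH hr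
    j (Nat.lt_succ_iff.1 (Finset.mem_range.1 j.2))
  choose w h1 h2 h3 h4 using hex
  refine ⟨fun i => ∑ j, w j i, fun i hi => ?_, fun P hP => ?_, ?_⟩
  · rw [Finset.sum_mul]
    let j₀ : Finset.range (N * Q + 1) := ⟨i, Finset.mem_range.2 (Nat.lt_succ_of_le hi)⟩
    refine le_trans ?_ (Finset.single_le_sum (fun j _ => h2 j i hi) (Finset.mem_univ j₀))
    rw [h1 j₀]
    rcases hG i hi with h | h <;> simp [j₀, h]
  · simp only [Finset.sum_mul]
    rw [Finset.sum_comm]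
    exact Finset.sum_eq_zero fun j _ => h3 j P hP
  · have h5 : ∀ i ∈ Finset.range (N * Q + 1), |∑ j, w j i| ≤
        (N * Q + 1 : ℕ) * ((N : ℝ) ^ H.card * Q ^ (3 * r + 1)) := by
      intro i _
      refine (Finset.abs_sum_le_sum_abs _ _).trans ?_
      refine (Finset.sum_le_card_nsmul _ _ _ fun j _ => h4 j i).trans_eq ?_
      rw [Finset.card_univ, Fintype.card_coe, Finset.card_range, nsmul_eq_mul]
    refine (Finset.sum_le_card_nsmul _ _ _ h5).trans_eq ?_
    rw [Finset.card_range, nsmul_eq_mul]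
    ring

/-- Shifted copies of `D` can be multiplied together so that many windows of length `Q` contain
many sign changes. -/
theorem exists_product_with_sign_changes (N Q r P : ℕ) (hQ : 0 < Q) (D : ℕ → ℝ)
    (hP : 2 * Q * (N - 1) ≤ P) (hD : ∀ i ≤ P + 2 * (N * Q), D i = 1 ∨ D i = -1)
    (hflip : 2 * r ≤ ((Finset.range Q).filter fun τ => D (P + 2 * τ) ≠ D (P + 2 * τ + 2)).card) :
    ∃ (C : Finset (Fin N)) (H : Finset ℕ), (∀ t ∈ H, t < N * Q) ∧
      (∀ t ∈ H, ∏ c ∈ C, D (P - 2 * Q * c + 2 * t) ≠ ∏ c ∈ C, D (P - 2 * Q * c + 2 * (t + 1))) ∧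
      (∀ a, (H.filter (· / Q = a)).card ≤ r) ∧ N * r ≤ 2 * H.card := by
  classical
  set G : Finset (Fin N) → ℕ → ℝ := fun C t => ∏ c ∈ C, D (P - 2 * Q * c + 2 * t) with hG
  set X : Finset (Fin N) → Fin N → Finset ℕ := fun C w =>
    (Finset.range (N * Q)).filter fun t => t / Q = w ∧ G C t ≠ G C (t + 1) with hX
  have hQc : ∀ c : Fin N, 2 * Q * (c : ℕ) ≤ P := fun c =>
    (Nat.mul_le_mul_left _ (by omega)).trans hP
  have hDc : ∀ (c : Fin N) (t : ℕ), t ≤ N * Q → D (P - 2 * Q * c + 2 * t) = 1 ∨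
      D (P - 2 * Q * c + 2 * t) = -1 := by
    intro c t ht
    exact hD _ (by have := hQc c; omega)
  have hGpm : ∀ (C : Finset (Fin N)) (t : ℕ), t ≤ N * Q → G C t = 1 ∨ G C t = -1 := by
    intro C t ht
    refine Finset.prod_induction _ (fun x : ℝ => x = 1 ∨ x = -1) ?_ (Or.inl rfl)
      fun c _ => hDc c t ht
    rintro a b (rfl | rfl) (rfl | rfl) <;> simp
  have hGsymm : ∀ (C : Finset (Fin N)) (c : Fin N) (t : ℕ), t ≤ N * Q →
      G (symmDiff C {c}) t = G C t * D (P - 2 * Q * c + 2 * t) := by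
    intro C c t ht
    have hsq : D (P - 2 * Q * c + 2 * t) * D (P - 2 * Q * c + 2 * t) = 1 := by
      rcases hDc c t ht with h | h <;> rw [h] <;> norm_num
    by_cases hc : c ∈ C
    · have h1 : symmDiff C {c} = C.erase c := by
        ext i; simp only [Finset.mem_symmDiff, Finset.mem_singleton, Finset.mem_erase]
        by_cases hi : i = c <;> simp [hi, hc]
      rw [h1]
      simp only [hG]
      rw [← Finset.prod_erase_mul C _ hc, mul_assoc, hsq, mul_one]
    · have h1 : symmDiff C {c} = insert c C := by
        ext i; simp only [Finset.mem_symmDiff, Finset.mem_singleton, Finset.mem_insert]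
        by_cases hi : i = c <;> simp [hi, hc]
      rw [h1]
      simp only [hG]
      rw [Finset.prod_insert hc, mul_comm]
  -- pairing `C` with its modification at the index `w`
  have hpair : ∀ (C : Finset (Fin N)) (w : Fin N),
      r ≤ min (X C w).card r + min (X (symmDiff C {w}) w).card r := by
    intro C w
    have h1 : ((Finset.range Q).filter fun τ => D (P + 2 * τ) ≠ D (P + 2 * τ + 2)).card ≤
        (X C w ∪ X (symmDiff C {w}) w).card := by
      refine Finset.card_le_card_of_injOn (fun τ => w * Q + τ) ?_ ?_
      · intro τ hτ
        obtain ⟨h2, h3⟩ := Finset.mem_filter.1 hτ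
        rw [Finset.mem_range] at h2
        have h4 : (w : ℕ) * Q + τ < N * Q := by
          have : ((w : ℕ) + 1) * Q ≤ N * Q := Nat.mul_le_mul_right _ w.2
          rw [add_mul] at this
          omega
        have h5 : ((w : ℕ) * Q + τ) / Q = w := by
          rw [mul_comm, Nat.mul_add_div hQ, Nat.div_eq_of_lt h2, add_zero]
        have h6 : P - 2 * Q * w + 2 * (w * Q + τ) = P + 2 * τ := by
          have h7 := hQc w
          have h8 : 2 * Q * (w : ℕ) = 2 * (w * Q) := by ring
          omega
        have h7 : P - 2 * Q * w + 2 * (w * Q + τ + 1) = P + 2 * τ + 2 := by omega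
        simp only [Finset.coe_union, Set.mem_union, Finset.mem_coe, hX, Finset.mem_filter,
          Finset.mem_range, h4, h5, true_and]
        rw [hGsymm C w _ h4.le, hGsymm C w _ h4, h6, h7]
        have h8 := hDc w _ h4.le
        have h9 := hDc w _ (Nat.succ_le_of_lt h4)
        rw [h6] at h8
        rw [Nat.succ_eq_add_one, h7] at h9
        rcases hGpm C _ h4.le with g1 | g1 <;> rcases hGpm C _ h4 with g2 | g2 <;>
          rcases h8 with g3 | g3 <;> rcases h9 with g4 | g4 <;>
          rw [g3, g4] at h3 <;> rw [g1, g2, g3, g4] <;>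
          first | (norm_num; done) | norm_num at h3
      · intro a _ b _ h
        simpa using h
    have h2 := Finset.card_union_le (X C w) (X (symmDiff C {w}) w)
    omega
  have hsum : ∑ C : Finset (Fin N), N * r ≤
      ∑ C : Finset (Fin N), 2 * ∑ w, min (X C w).card r := by
    have h1 : ∀ w : Fin N, ∑ C : Finset (Fin N), r ≤ ∑ C, 2 * min (X C w).card r := by
      intro w
      have hinv : Function.Involutive fun C : Finset (Fin N) => symmDiff C {w} :=
        fun C => symmDiff_symmDiff_cancel_right _ _
      have h2 : ∑ C : Finset (Fin N), min (X (symmDiff C {w}) w).card r =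
          ∑ C, min (X C w).card r := Equiv.sum_comp hinv.toPerm fun C => min (X C w).card r
      calc ∑ C : Finset (Fin N), r ≤
            ∑ C, (min (X C w).card r + min (X (symmDiff C {w}) w).card r) :=
            Finset.sum_le_sum fun C _ => hpair C w
        _ = _ := by rw [Finset.sum_add_distrib, h2, ← Finset.mul_sum, two_mul]
    have h2 := Finset.sum_le_sum fun (w : Fin N) (_ : w ∈ Finset.univ) => h1 w
    rw [Finset.sum_comm, Finset.sum_comm (t := (Finset.univ : Finset (Finset (Fin N))))] at h2
    simpa [Finset.mul_sum] using h2
  obtain ⟨C, -, hC⟩ := Finset.exists_le_of_sum_le ⟨∅, Finset.mem_univ _⟩ hsum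
  have hS : ∀ w, ∃ S ⊆ X C w, S.card = min (X C w).card r := fun w =>
    Finset.exists_subset_card_eq (min_le_left _ _)
  choose S hSX hSc using hS
  have hSmem : ∀ w, ∀ t ∈ S w, t < N * Q ∧ t / Q = w ∧ G C t ≠ G C (t + 1) := by
    intro w t ht
    simpa [hX] using hSX w ht
  refine ⟨C, Finset.univ.biUnion S, ?_, ?_, ?_, ?_⟩
  · intro t ht
    obtain ⟨w, -, hw⟩ := Finset.mem_biUnion.1 ht
    exact (hSmem w t hw).1
  · intro t ht
    obtain ⟨w, -, hw⟩ := Finset.mem_biUnion.1 ht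
    exact (hSmem w t hw).2.2
  · intro a
    by_cases ha : a < N
    · refine (Finset.card_le_card (t := S ⟨a, ha⟩) ?_).trans ((hSc _).trans_le (min_le_right _ _))
      intro t ht
      obtain ⟨h1, h2⟩ := Finset.mem_filter.1 ht
      obtain ⟨w, -, hw⟩ := Finset.mem_biUnion.1 h1
      have h3 : w = ⟨a, ha⟩ := Fin.ext ((hSmem w t hw).2.1.symm.trans h2)
      rwa [h3] at hw
    · rw [Finset.filter_eq_empty_iff.2]
      · simp
      · intro t ht h2
        obtain ⟨w, -, hw⟩ := Finset.mem_biUnion.1 ht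
        exact ha (by rw [← h2, (hSmem w t hw).2.1]; exact w.2)
  · rw [Finset.card_biUnion]
    · simpa [hSc] using hC
    · intro v _ w _ hvw
      refine Finset.disjoint_left.2 fun t h1 h2 => hvw (Fin.ext ?_)
      rw [← (hSmem v t h1).2.1, (hSmem w t h2).2.1]

open Matrix in
/-- The rank of an entrywise product of matrices is at most the product of their ranks. -/
theorem rank_hadamard_le {X Y : Type*} [Fintype X] [Fintype Y] (A B : Matrix X Y ℝ) :
    (Matrix.of fun x y => A x y * B x y).rank ≤ A.rank * B.rank := by
  obtain ⟨u, v, huv⟩ := exists_dotProduct_of_rank A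
  obtain ⟨u', v', huv'⟩ := exists_dotProduct_of_rank B
  have h : (Matrix.of fun x y => A x y * B x y) =
      (Matrix.of fun x (k : Fin A.rank × Fin B.rank) => u x k.1 * u' x k.2) *
      (Matrix.of fun (k : Fin A.rank × Fin B.rank) y => v y k.1 * v' y k.2) := by
    ext x y
    simp only [Matrix.of_apply, Matrix.mul_apply, huv, huv', dotProduct, Fintype.sum_prod_type,
      Finset.sum_mul_sum]
    exact Finset.sum_congr rfl fun i _ => Finset.sum_congr rfl fun j _ => by ring
  rw [h]
  refine (Matrix.rank_mul_le_left _ _).trans ((Matrix.rank_le_card_width _).trans ?_)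
  simp

open Matrix in
/-- The rank of a finite entrywise product of matrices of rank at most `R`. -/
theorem rank_prod_hadamard_le {X Y ι : Type*} [Fintype X] [Fintype Y] (R : ℕ)
    (A : ι → Matrix X Y ℝ) (C : Finset ι) (hA : ∀ c ∈ C, (A c).rank ≤ R) :
    (Matrix.of fun x y => ∏ c ∈ C, A c x y).rank ≤ R ^ C.card := by
  classical
  induction C using Finset.induction_on with
  | empty =>
    have h : (Matrix.of fun (x : X) (y : Y) => ∏ c ∈ (∅ : Finset ι), A c x y) =
        (Matrix.of fun (_ : X) (_ : Unit) => (1 : ℝ)) *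
          (Matrix.of fun (_ : Unit) (_ : Y) => (1 : ℝ)) := by
      ext x y
      simp [Matrix.mul_apply]
    rw [h]
    refine (Matrix.rank_mul_le_left _ _).trans ((Matrix.rank_le_card_width _).trans ?_)
    simp
  | insert a s ha ih =>
    have h : (Matrix.of fun x y => ∏ c ∈ insert a s, A c x y) =
        Matrix.of fun x y => A a x y * (Matrix.of fun x y => ∏ c ∈ s, A c x y) x y := by
      ext x y
      simp [Finset.prod_insert ha]
    rw [h, Finset.card_insert_of_notMem ha, pow_succ, mul_comm]
    exact (rank_hadamard_le _ _).trans (Nat.mul_le_mul (hA a (Finset.mem_insert_self _ _))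
      (ih fun c hc => hA c (Finset.mem_insert_of_mem hc)))

/-- A sign-representing matrix attaining the sign-rank. -/
theorem exists_rank_eq_signRank {X Y : Type} [Fintype X] [Fintype Y] (F : Matrix X Y ℝ)
    (hF : ∀ x y, F x y ≠ 0) :
    ∃ A : Matrix X Y ℝ, (∀ x y, 0 < A x y * F x y) ∧ A.rank = signRank F :=
  Nat.sInf_mem (s := {r : ℕ | ∃ A : Matrix X Y ℝ, (∀ x y, 0 < A x y * F x y) ∧ A.rank = r})
    ⟨F.rank, F, fun x y => mul_self_pos.2 (hF x y), rfl⟩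

/-- The pattern-matrix rank bound for a sign function with many, evenly spread, sign changes. -/
theorem signs_rank_bound (N Q r β : ℕ) (hN : 0 < N) (hQ : 0 < Q) (hβ : 0 < β) (G : ℕ → ℝ)
    (hG : ∀ t ≤ N * Q, G t = 1 ∨ G t = -1) (H : Finset ℕ) (hHB : ∀ t ∈ H, t < N * Q)
    (hH : ∀ t ∈ H, G t ≠ G (t + 1)) (hr : ∀ a, (H.filter (· / Q = a)).card ≤ r)
    (A : Matrix (Fin (N * Q) × Fin (β ^ 2) → Bool)
      ((Fin (N * Q) → Fin (β ^ 2)) × (Fin (N * Q) → Bool)) ℝ)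
    (hA : ∀ x y, 0 < G (boolWeight fun i => xor (x (i, y.1 i)) (y.2 i)) * A x y) :
    (β : ℝ) ^ (H.card - 2) ≤
      ((N * Q + 1 : ℕ) : ℝ) ^ 2 * ((N : ℝ) ^ H.card * Q ^ (3 * r + 1)) * A.rank := by
  obtain ⟨w, hw1, hann, hW⟩ := exists_annihilating_weights N Q r hN hQ G hG H hHB hH hr
  have hcard : H.card ≤ N * Q := by
    simpa using Finset.card_le_card (fun t ht => Finset.mem_range.2 (hHB t ht) :
      H ⊆ Finset.range (N * Q))
  have hN1 : (1 : ℝ) ≤ N := by exact_mod_cast hN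
  have hQ1 : (1 : ℝ) ≤ Q := by exact_mod_cast hQ
  have hβ1 : (1 : ℝ) ≤ β := by exact_mod_cast hβ
  have hW1 : (1 : ℝ) ≤ ((N * Q + 1 : ℕ) : ℝ) ^ 2 * ((N : ℝ) ^ H.card * Q ^ (3 * r + 1)) :=
    one_le_mul_of_one_le_of_one_le (one_le_pow₀ (by push_cast; nlinarith))
      (one_le_mul_of_one_le_of_one_le (one_le_pow₀ hN1) (one_le_pow₀ hQ1))
  have : Nonempty (Fin (β ^ 2)) := ⟨⟨0, by positivity⟩⟩
  by_cases hR : A.rank < 2 ^ Fintype.card (Fin (N * Q) × Fin (β ^ 2))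
  · have key := pattern_rank_bound w (H.card - 2) _ (by simp; omega)
      (by simpa using hann) (fun j hj => ?_) (by simpa using hW) A (fun x y => ?_) hR
    · simp only [Fintype.card_fin] at key
      refine (pow_le_pow_iff_left₀ (by positivity) (by positivity) two_ne_zero).1 ?_
      push_cast at key ⊢
      rw [mul_pow, ← pow_mul, mul_comm (_ - 2), pow_mul]
      exact key
    · rw [Fintype.card_fin] at hj
      refine (hw1 j hj).trans ((le_abs_self _).trans ?_)
      rw [abs_mul]
      rcases hG j hj with h | h <;> simp [h]
    · have hle : (boolWeight fun i => xor (x (i, y.1 i)) (y.2 i)) ≤ N * Q := by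
        simpa using boolWeight_le fun i => xor (x (i, y.1 i)) (y.2 i)
      have h1 := hw1 _ hle
      have h2 := hA x y
      rcases hG _ hle with h | h <;> rw [h] at h1 h2 <;> nlinarith
  · rw [not_lt] at hR
    have h1 : (β : ℝ) ^ (H.card - 2) ≤ A.rank := by
      calc (β : ℝ) ^ (H.card - 2) ≤ β ^ (N * Q) := pow_le_pow_right₀ hβ1 (by omega)
        _ ≤ (2 ^ β ^ 2) ^ (N * Q) := by
          refine pow_le_pow_left₀ (by positivity) ?_ _
          have : β < 2 ^ β ^ 2 := Nat.lt_two_pow_self.trans_le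
            (Nat.pow_le_pow_right (by norm_num) (by nlinarith))
          exact_mod_cast this.le
        _ = 2 ^ (N * Q * β ^ 2) := by rw [← pow_mul, mul_comm]
        _ ≤ A.rank := by
          have : 2 ^ (N * Q * β ^ 2) ≤ A.rank := by simpa using hR
          exact_mod_cast this
    exact h1.trans (le_mul_of_one_le_left (by positivity) hW1)

/-- Padding two Boolean vectors by zeros does not change the weight of their XOR. -/
theorem hamW_bxor_extend {K : Type*} [Fintype K] {n : ℕ} (e : K ↪ Fin n) (f g : K → Bool) :
    hamW (bxor (Function.extend e f fun _ => false) (Function.extend e g fun _ => false)) =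
      ∑ k, (xor (f k) (g k)).toNat := by
  classical
  have h : ∀ k, (xor (f k) (g k)).toNat = if xor (f k) (g k) = true then 1 else 0 := fun k => by
    cases xor (f k) (g k) <;> rfl
  simp only [h]
  rw [← Finset.card_filter, ← Finset.card_map e, hamW]
  congr 1
  ext j
  rw [Finset.mem_filter, Finset.mem_map]
  simp only [Finset.mem_filter, Finset.mem_univ, true_and]
  rw [bxor]
  by_cases hj : ∃ k, e k = j
  · obtain ⟨k, rfl⟩ := hj
    rw [e.injective.extend_apply, e.injective.extend_apply]
    simp
  · rw [Function.extend_apply' _ _ _ hj, Function.extend_apply' _ _ _ hj]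
    simp only [Bool.xor_false, Bool.false_eq_true, false_iff]
    rintro ⟨k, -, hk⟩
    exact hj ⟨k, hk⟩

/-- The pattern matrix of `t ↦ D (m + 2 t)` is a submatrix of `D (|x ⊕ y|)`. -/
theorem exists_pattern_embedding (B b m n : ℕ) (hb : 0 < b) (h1 : B * (b - 1) ≤ m)
    (h2 : m + B * (b + 1) ≤ n) :
    ∃ (X : (Fin B × Fin b → Bool) → Fin n → Bool)
      (Y : ((Fin B → Fin b) × (Fin B → Bool)) → Fin n → Bool), ∀ x y,
        hamW (bxor (X x) (Y y)) =
          m + 2 * boolWeight fun i => xor (x (i, y.1 i)) (y.2 i) := by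
  classical
  set s := m - B * (b - 1) with hs
  have hbb : B * (b - 1) + B * (b + 1) = 2 * (B * b) := by
    obtain ⟨c, rfl⟩ := Nat.exists_eq_succ_of_ne_zero hb.ne'
    simp only [Nat.succ_eq_add_one, Nat.add_sub_cancel]
    ring
  have hcard : Fintype.card ((Fin B × Fin b × Bool) ⊕ Fin s) ≤ Fintype.card (Fin n) := by
    simp only [Fintype.card_sum, Fintype.card_prod, Fintype.card_fin, Fintype.card_bool]
    have : B * (b * 2) = 2 * (B * b) := by ring
    omega
  obtain ⟨e⟩ := Function.Embedding.nonempty_of_card_le hcard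
  refine ⟨fun x => Function.extend e (Sum.elim (fun k => !(xor (x (k.1, k.2.1)) k.2.2))
      fun _ => false) fun _ => false,
    fun y => Function.extend e (Sum.elim (fun k => decide (k.2.1 = y.1 k.1 ∧ k.2.2 = y.2 k.1))
      fun _ => true) fun _ => false, fun x y => ?_⟩
  rw [hamW_bxor_extend, Fintype.sum_sum_type]
  simp only [Sum.elim_inl, Sum.elim_inr, Fintype.sum_prod_type, Fintype.sum_bool]
  have hblock : ∀ (i : Fin B) (v : Fin b),
      (xor (!(xor (x (i, v)) true)) (decide (v = y.1 i ∧ true = y.2 i))).toNat +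
        (xor (!(xor (x (i, v)) false)) (decide (v = y.1 i ∧ false = y.2 i))).toNat =
      if v = y.1 i then 2 * (xor (x (i, y.1 i)) (y.2 i)).toNat else 1 := by
    intro i v
    by_cases hv : v = y.1 i
    · subst hv
      cases x (i, y.1 i) <;> cases y.2 i <;> simp
    · cases x (i, v) <;> simp [hv]
  have hrow : ∀ i : Fin B, (∑ v : Fin b, if v = y.1 i then
      2 * (xor (x (i, y.1 i)) (y.2 i)).toNat else 1) =
      2 * (xor (x (i, y.1 i)) (y.2 i)).toNat + (b - 1) := by
    intro i
    rw [Finset.sum_ite, Finset.sum_const, Finset.sum_const, Finset.filter_eq',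
      if_pos (Finset.mem_univ _), Finset.filter_ne', Finset.card_erase_of_mem (Finset.mem_univ _)]
    simp
  have hw : boolWeight (fun i => xor (x (i, y.1 i)) (y.2 i)) =
      ∑ i, (xor (x (i, y.1 i)) (y.2 i)).toNat := by
    rw [boolWeight, Finset.card_filter]
    refine Finset.sum_congr rfl fun i _ => ?_
    cases xor (x (i, y.1 i)) (y.2 i) <;> rfl
  simp only [hblock, hrow, hw]
  rw [Finset.sum_add_distrib, ← Finset.mul_sum]
  simp only [Finset.sum_const, Finset.card_univ, Fintype.card_fin, smul_eq_mul, Bool.xor_true,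
    Bool.not_false, Bool.toNat_true, mul_one]
  omega

theorem rank_pos_of_apply_ne_zero {X Y : Type*} [Fintype X] [Fintype Y] (A : Matrix X Y ℝ)
    (x : X) (y : Y) (h : A x y ≠ 0) : 0 < A.rank := by
  obtain ⟨u, v, huv⟩ := exists_dotProduct_of_rank A
  by_contra! h0
  refine h ?_
  have : IsEmpty (Fin A.rank) := by
    rw [Nat.le_zero.1 h0]
    infer_instance
  rw [huv, dotProduct, Finset.univ_eq_empty, Finset.sum_empty]

/-- Many sign changes of `D` in a window of one parity force a large rank. -/
theorem exists_pow_le_rank_pow (n N Q r β P : ℕ) (hN : 0 < N) (hQ : 0 < Q) (hβ : 0 < β)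
    (D : ℕ → ℝ) (hD : ∀ i ≤ n, D i = 1 ∨ D i = -1)
    (A : Matrix (Fin n → Bool) (Fin n → Bool) ℝ)
    (hA : ∀ x y, 0 < A x y * D (hamW (bxor x y)))
    (hP1 : 2 * Q * (N - 1) + N * Q * (β ^ 2 - 1) ≤ P) (hP2 : P + N * Q * (β ^ 2 + 1) ≤ n)
    (hflip : 2 * r ≤ ((Finset.range Q).filter fun τ => D (P + 2 * τ) ≠ D (P + 2 * τ + 2)).card) :
    ∃ h : ℕ, N * r ≤ 2 * h ∧ (β : ℝ) ^ (h - 2) ≤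
      ((N * Q + 1 : ℕ) : ℝ) ^ 2 * ((N : ℝ) ^ h * Q ^ (3 * r + 1)) * (A.rank : ℝ) ^ N := by
  have hβ2 : 1 ≤ β ^ 2 := Nat.one_le_pow _ _ hβ
  have hPn : P + 2 * (N * Q) ≤ n := by nlinarith [Nat.zero_le (N * Q)]
  obtain ⟨C, H, hHB, hH, hr, hNr⟩ := exists_product_with_sign_changes N Q r P hQ D
    ((Nat.le_add_right _ _).trans hP1) (fun i hi => hD i (hi.trans hPn)) hflip
  have hQc : ∀ c : Fin N, 2 * Q * (c : ℕ) ≤ 2 * Q * (N - 1) := fun c =>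
    Nat.mul_le_mul_left _ (by omega)
  have hemb : ∀ c : Fin N, ∃ (X : (Fin (N * Q) × Fin (β ^ 2) → Bool) → Fin n → Bool)
      (Y : ((Fin (N * Q) → Fin (β ^ 2)) × (Fin (N * Q) → Bool)) → Fin n → Bool), ∀ x y,
        hamW (bxor (X x) (Y y)) =
          P - 2 * Q * c + 2 * boolWeight fun i => xor (x (i, y.1 i)) (y.2 i) := fun c =>
    exists_pattern_embedding _ _ _ _ hβ2 (by have := hQc c; omega) (by omega)
  choose X Y hXY using hemb
  refine ⟨H.card, hNr, ?_⟩
  have hpos : 0 < A.rank := rank_pos_of_apply_ne_zero A (fun _ => false) (fun _ => false)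
    fun h => by simpa [h] using hA (fun _ => false) (fun _ => false)
  refine (signs_rank_bound N Q r β hN hQ hβ (fun t => ∏ c ∈ C, D (P - 2 * Q * c + 2 * t)) ?_ H hHB
    hH hr (Matrix.of fun x y => ∏ c ∈ C, (A.submatrix (X c) (Y c)) x y) ?_).trans ?_
  · intro t ht
    refine Finset.prod_induction _ (fun x : ℝ => x = 1 ∨ x = -1) ?_ (Or.inl rfl)
      fun c _ => hD _ (by omega)
    rintro a b (rfl | rfl) (rfl | rfl) <;> simp
  · intro x y
    rw [Matrix.of_apply, ← Finset.prod_mul_distrib]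
    refine Finset.prod_pos fun c _ => ?_
    rw [Matrix.submatrix_apply, mul_comm, ← hXY c x y]
    exact hA _ _
  · refine mul_le_mul_of_nonneg_left ?_ (by positivity)
    have h1 := rank_prod_hadamard_le A.rank (fun c => A.submatrix (X c) (Y c)) C
      fun c _ => Matrix.rank_submatrix_le _ _ _
    have h2 : A.rank ^ C.card ≤ A.rank ^ N :=
      Nat.pow_le_pow_right hpos (by simpa using Finset.card_le_univ C)
    exact_mod_cast h1.trans h2

theorem two_pow_le_sq_of_pow_le (ℓ Q r h R : ℕ) (hℓ : 1 ≤ ℓ) (hr : 1 ≤ r) (hQ : 0 < Q)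
    (hQℓ : Q ≤ 2 ^ ℓ) (hh : 128 * ℓ * r ≤ 2 * h)
    (H : (4 * (128 * ℓ)) ^ (h - 2) ≤
      (128 * ℓ * Q + 1) ^ 2 * ((128 * ℓ) ^ h * Q ^ (3 * r + 1)) * R ^ (128 * ℓ)) :
    2 ^ r ≤ R ^ 2 := by
  set N := 128 * ℓ with hN
  have hN0 : 0 < N := by omega
  have hrℓ : ℓ ≤ ℓ * r := Nat.le_mul_of_pos_right _ hr
  have hh2 : 2 ≤ h := by
    have : 128 * ℓ * r = 128 * (ℓ * r) := by ring
    rw [hN] at hh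
    omega
  have hN2 : N ≤ 2 ^ (8 * ℓ) := by
    calc N ≤ 2 ^ 7 * 2 ^ ℓ := by
          have := (Nat.lt_two_pow_self (n := ℓ)).le
          omega
      _ = 2 ^ (7 + ℓ) := (pow_add _ _ _).symm
      _ ≤ _ := Nat.pow_le_pow_right (by norm_num) (by omega)
  have hNQ : N * Q + 1 ≤ 2 ^ (10 * ℓ) := by
    calc N * Q + 1 ≤ 2 * (N * Q) := by have := Nat.mul_pos hN0 hQ; omega
      _ ≤ 2 * (2 ^ (8 * ℓ) * 2 ^ ℓ) := by gcongr
      _ = 2 ^ (1 + (8 * ℓ + ℓ)) := by rw [pow_add, pow_add, pow_one]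
      _ ≤ _ := Nat.pow_le_pow_right (by norm_num) (by omega)
  have h16 : 16 * N ^ 2 ≤ 2 ^ (20 * ℓ) := by
    calc 16 * N ^ 2 ≤ 2 ^ 4 * (2 ^ (8 * ℓ)) ^ 2 := by gcongr; norm_num
      _ = 2 ^ (4 + 8 * ℓ * 2) := by rw [pow_add, pow_mul _ _ 2]
      _ ≤ _ := Nat.pow_le_pow_right (by norm_num) (by omega)
  have hQr : Q ^ (3 * r + 1) ≤ 2 ^ (4 * (ℓ * r)) := by
    calc Q ^ (3 * r + 1) ≤ (2 ^ ℓ) ^ (3 * r + 1) := by gcongr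
      _ = 2 ^ (ℓ * (3 * r + 1)) := (pow_mul _ _ _).symm
      _ ≤ _ := Nat.pow_le_pow_right (by norm_num) (by nlinarith)
  have h4 : 4 ^ h * N ^ h ≤ (16 * N ^ 2 * (N * Q + 1) ^ 2 * Q ^ (3 * r + 1) * R ^ N) * N ^ h := by
    calc 4 ^ h * N ^ h = (4 * N) ^ 2 * (4 * N) ^ (h - 2) := by
          rw [← mul_pow, ← pow_add]; congr 1; omega
      _ ≤ (4 * N) ^ 2 * _ := Nat.mul_le_mul_left _ H
      _ = _ := by ring
  have h5 := Nat.le_of_mul_le_mul_right h4 (by positivity)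
  have h6 : 16 * N ^ 2 * (N * Q + 1) ^ 2 * Q ^ (3 * r + 1) ≤ 2 ^ (64 * (ℓ * r)) := by
    calc 16 * N ^ 2 * (N * Q + 1) ^ 2 * Q ^ (3 * r + 1)
        ≤ 2 ^ (20 * ℓ) * (2 ^ (10 * ℓ)) ^ 2 * 2 ^ (4 * (ℓ * r)) := by gcongr
      _ = 2 ^ (20 * ℓ + 10 * ℓ * 2 + 4 * (ℓ * r)) := by rw [pow_add, pow_add, pow_mul _ _ 2]
      _ ≤ _ := Nat.pow_le_pow_right (by norm_num) (by omega)
  have h7 : 2 ^ (64 * (ℓ * r)) * 2 ^ (64 * (ℓ * r)) ≤ 2 ^ (64 * (ℓ * r)) * R ^ N := by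
    calc 2 ^ (64 * (ℓ * r)) * 2 ^ (64 * (ℓ * r)) = 2 ^ (N * r) := by
          rw [← pow_add]; congr 1; rw [hN]; ring
      _ ≤ 2 ^ (2 * h) := Nat.pow_le_pow_right (by norm_num) hh
      _ = 4 ^ h := by rw [pow_mul]; norm_num
      _ ≤ _ := h5.trans (Nat.mul_le_mul_right _ h6)
  have h8 := Nat.le_of_mul_le_mul_left h7 (by positivity)
  refine (Nat.pow_le_pow_iff_left (n := 64 * ℓ) (by omega)).1 ?_
  rw [← pow_mul, ← pow_mul]
  convert h8 using 2
  · ring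
  · rw [hN]; ring

/-- A dyadic pigeonhole: a set of numbers in `[0, n / 2)` has many elements of one parity in a
window which is far away from `0` and from `n` compared with its length. -/
theorem exists_dense_window (n Λ ℓ a : ℕ) (hΛ : 0 < Λ) (hℓ : 1 ≤ ℓ) (hn : n ≤ 2 ^ ℓ)
    (S : Finset ℕ) (hS : ∀ i ∈ S, 2 * i + 2 ≤ n) (hcard : 2 * Λ + 4 * Λ * ℓ * a ≤ S.card) :
    ∃ Q P : ℕ, 0 < Q ∧ Q ≤ 2 ^ ℓ ∧ (0 < a → Q * Λ ≤ P ∧ P + Q * Λ ≤ n) ∧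
      a ≤ ((Finset.range Q).filter fun τ => P + 2 * τ ∈ S).card := by
  classical
  set S' := S.filter (2 * Λ ≤ ·) with hS'
  have hlog : ∀ i ∈ S', 2 * Λ * 2 ^ Nat.log 2 (i / (2 * Λ)) ≤ i ∧
      i < 2 * (2 * Λ * 2 ^ Nat.log 2 (i / (2 * Λ))) ∧ Nat.log 2 (i / (2 * Λ)) < ℓ := by
    intro i hi
    obtain ⟨h1, h2⟩ := Finset.mem_filter.1 hi
    have h3 : i / (2 * Λ) ≠ 0 := (Nat.div_pos h2 (by omega)).ne'
    have h4 := Nat.pow_log_le_self 2 h3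
    have h5 := Nat.lt_pow_succ_log_self (b := 2) (by norm_num) (i / (2 * Λ))
    refine ⟨?_, ?_, ?_⟩
    · rw [mul_comm]
      exact (Nat.le_div_iff_mul_le (by omega)).1 h4
    · rw [Nat.div_lt_iff_lt_mul (by omega), pow_succ] at h5
      nlinarith
    · have h6 : 2 ^ Nat.log 2 (i / (2 * Λ)) < 2 ^ ℓ :=
        h4.trans_lt ((Nat.div_le_self _ _).trans_lt (by have := hS i h1; omega))
      exact (Nat.pow_lt_pow_iff_right (by norm_num)).1 h6
  have hcard' : 4 * Λ * ℓ * a ≤ S'.card := by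
    have h1 : S.card ≤ S'.card + 2 * Λ := by
      rw [← Finset.card_filter_add_card_filter_not (s := S) (2 * Λ ≤ ·)]
      refine Nat.add_le_add_left ?_ _
      refine (Finset.card_le_card (t := Finset.range (2 * Λ)) fun i hi => ?_).trans_eq
        (Finset.card_range _)
      simpa using (Finset.mem_filter.1 hi).2
    omega
  let key : ℕ → ℕ × ℕ × ℕ := fun i =>
    (Nat.log 2 (i / (2 * Λ)), i / (2 * 2 ^ Nat.log 2 (i / (2 * Λ))), i % 2)
  obtain ⟨⟨l, u, e⟩, hk, ha⟩ := Finset.exists_le_card_fiber_of_mul_le_card_of_maps_to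
    (s := S') (t := Finset.range ℓ ×ˢ Finset.range (2 * Λ) ×ˢ Finset.range 2) (f := key) (n := a)
    (fun i hi => by
      obtain ⟨h1, h2, h3⟩ := hlog i hi
      simp only [key, Finset.mem_product, Finset.mem_range]
      refine ⟨h3, ?_, Nat.mod_lt _ (by norm_num)⟩
      rw [Nat.div_lt_iff_lt_mul (by positivity)]
      nlinarith)
    ⟨(0, 0, 0), by simp; omega⟩
    (by simpa using (by linarith : ℓ * (2 * Λ * 2) * a ≤ S'.card))
  simp only [Finset.mem_product, Finset.mem_range] at hk
  have hfib : ∀ i ∈ S'.filter (key · = (l, u, e)), 2 * Λ * 2 ^ l ≤ i ∧ i < 2 * (2 * Λ * 2 ^ l) ∧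
      i / (2 * 2 ^ l) = u ∧ i % 2 = e ∧ i ∈ S ∧ 2 * i + 2 ≤ n := by
    intro i hi
    obtain ⟨h1, h2⟩ := Finset.mem_filter.1 hi
    simp only [key, Prod.mk.injEq] at h2
    obtain ⟨h3, h4, h5⟩ := h2
    rw [h3] at h4
    have h6 := hlog i h1
    rw [h3] at h6
    have h7 := (Finset.mem_filter.1 h1).1
    exact ⟨h6.1, h6.2.1, h4, h5, h7, hS i h7⟩
  have hi_eq : ∀ i ∈ S'.filter (key · = (l, u, e)), ∃ τ < 2 ^ l, i = 2 * 2 ^ l * u + e + 2 * τ := by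
    intro i hi
    obtain ⟨-, -, h1, h2, -, -⟩ := hfib i hi
    have h3 := Nat.div_add_mod i (2 * 2 ^ l)
    have h4 := Nat.mod_lt i (show 0 < 2 * 2 ^ l by positivity)
    have h5 : i % (2 * 2 ^ l) % 2 = e := by
      rw [Nat.mod_mod_of_dvd _ (Dvd.intro _ rfl), h2]
    rw [h1] at h3
    refine ⟨i % (2 * 2 ^ l) / 2, by omega, by omega⟩
  refine ⟨2 ^ l, 2 * 2 ^ l * u + e, by positivity, Nat.pow_le_pow_right (by norm_num) hk.1.le,
    fun ha0 => ?_, ha.trans ?_⟩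
  · obtain ⟨i, hi⟩ := Finset.card_pos.1 (ha0.trans_le ha)
    obtain ⟨h1, h2, h3, h4, h5, h6⟩ := hfib i hi
    obtain ⟨τ, h7, h8⟩ := hi_eq i hi
    have h9 : Λ ≤ u := by
      rw [← h3, Nat.le_div_iff_mul_le (by positivity)]
      linarith
    have h10 : 2 ^ l * Λ ≤ 2 ^ l * u := Nat.mul_le_mul_left _ h9
    constructor <;> nlinarith
  · refine (Finset.card_le_card (t := ((Finset.range (2 ^ l)).filter fun τ =>
      2 * 2 ^ l * u + e + 2 * τ ∈ S).image fun τ => 2 * 2 ^ l * u + e + 2 * τ)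
      fun i hi => ?_).trans Finset.card_image_le
    obtain ⟨τ, h7, h8⟩ := hi_eq i hi
    refine Finset.mem_image.2 ⟨τ, Finset.mem_filter.2 ⟨Finset.mem_range.2 h7, ?_⟩, h8.symm⟩
    rw [← h8]
    exact (hfib i hi).2.2.2.2.1

/-- Many sign changes of `D` at distance two in the lower half force a large rank. -/
theorem two_pow_le_rank_sq (n ℓ r : ℕ) (hℓ : 1 ≤ ℓ) (hr : 1 ≤ r) (hn : n ≤ 2 ^ ℓ) (D : ℕ → ℝ)
    (hD : ∀ i ≤ n, D i = 1 ∨ D i = -1) (A : Matrix (Fin n → Bool) (Fin n → Bool) ℝ)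
    (hA : ∀ x y, 0 < A x y * D (hamW (bxor x y))) (S : Finset ℕ) (hS : ∀ i ∈ S, 2 * i + 2 ≤ n)
    (hflip : ∀ i ∈ S, D i ≠ D (i + 2)) (hcard : 10 * 2 ^ 26 * ℓ ^ 4 * r ≤ S.card) :
    2 ^ r ≤ A.rank ^ 2 := by
  classical
  have hΛ : 128 * ℓ * ((512 * ℓ) ^ 2 + 2) ≤ 2 ^ 26 * ℓ ^ 3 := by
    have : ℓ ≤ ℓ ^ 3 := Nat.le_self_pow (by norm_num) _
    calc 128 * ℓ * ((512 * ℓ) ^ 2 + 2) = 2 ^ 25 * ℓ ^ 3 + 256 * ℓ := by ring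
      _ ≤ _ := by omega
  set Λ := 128 * ℓ * ((512 * ℓ) ^ 2 + 2) with hΛdef
  have hcard' : 2 * Λ + 4 * Λ * ℓ * (2 * r) ≤ S.card := by
    have h1 : 1 ≤ ℓ * r := Nat.mul_pos hℓ hr
    calc 2 * Λ + 4 * Λ * ℓ * (2 * r) ≤ 2 * Λ * (ℓ * r) + 8 * Λ * (ℓ * r) := by nlinarith
      _ = 10 * (ℓ * r) * Λ := by ring
      _ ≤ 10 * (ℓ * r) * (2 ^ 26 * ℓ ^ 3) := Nat.mul_le_mul_left _ hΛ
      _ = 10 * 2 ^ 26 * ℓ ^ 4 * r := by ring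
      _ ≤ _ := hcard
  obtain ⟨Q, P, hQ, hQℓ, hP, ha⟩ := exists_dense_window n Λ ℓ (2 * r) (by positivity) hℓ hn S hS
    hcard'
  obtain ⟨hP1, hP2⟩ := hP (by omega)
  have hΛQ : Q * Λ = 128 * ℓ * Q * (512 * ℓ) ^ 2 + 2 * Q * (128 * ℓ) := by rw [hΛdef]; ring
  obtain ⟨h, h1, h2⟩ := exists_pow_le_rank_pow n (128 * ℓ) Q r (4 * (128 * ℓ)) P (by omega) hQ
    (by omega) D hD A hA
    (by
      have e1 : 2 * Q * (128 * ℓ - 1) ≤ 2 * Q * (128 * ℓ) := Nat.mul_le_mul_left _ (by omega)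
      have e2 : 128 * ℓ * Q * ((4 * (128 * ℓ)) ^ 2 - 1) ≤ 128 * ℓ * Q * (512 * ℓ) ^ 2 :=
        Nat.mul_le_mul_left _ ((Nat.sub_le _ _).trans (by rw [← mul_assoc]; norm_num))
      omega)
    (by
      have e1 : 128 * ℓ * Q * ((4 * (128 * ℓ)) ^ 2 + 1) =
        128 * ℓ * Q * (512 * ℓ) ^ 2 + Q * (128 * ℓ) := by ring
      have e2 : 2 * Q * (128 * ℓ) = 2 * (Q * (128 * ℓ)) := by ring
      omega)
    (ha.trans (Finset.card_le_card fun τ hτ => by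
      rw [Finset.mem_filter] at hτ ⊢
      exact ⟨hτ.1, hflip _ hτ.2⟩))
  exact two_pow_le_sq_of_pow_le ℓ Q r h A.rank hℓ hr hQ hQℓ h1 (by exact_mod_cast h2)

theorem hamW_val_eq_card {n : ℕ} (p : ℕ → Bool) :
    hamW (fun j : Fin n => p j) = ((Finset.range n).filter fun j => p j = true).card := by
  rw [hamW, Finset.card_filter, Finset.card_filter, Finset.sum_range]

theorem hamW_bxor_not {n : ℕ} (x y : Fin n → Bool) :
    hamW (bxor (fun i => !x i) y) = n - hamW (bxor x y) := by
  have h : hamW (bxor (fun i => !x i) y) + hamW (bxor x y) = n := by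
    have h1 := Finset.card_filter_add_card_filter_not (s := (Finset.univ : Finset (Fin n)))
      (fun i => bxor x y i = true)
    rw [Finset.card_univ, Fintype.card_fin] at h1
    rw [add_comm, hamW, hamW]
    convert h1 using 3
    ext i
    simp only [bxor]
    cases x i <;> cases y i <;> simp
  omega

/-- A sign matrix of a symmetric XOR function with a sign change at distance two is not
represented by a matrix of rank one. -/
theorem two_le_rank_of_flip (n i : ℕ) (hi : i + 2 ≤ n) (D : ℕ → ℝ)
    (hD : ∀ i ≤ n, D i = 1 ∨ D i = -1) (hflip : D i ≠ D (i + 2))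
    (A : Matrix (Fin n → Bool) (Fin n → Bool) ℝ)
    (hA : ∀ x y, 0 < A x y * D (hamW (bxor x y))) : 2 ≤ A.rank := by
  by_contra! hR
  obtain ⟨u, v, huv⟩ := exists_dotProduct_of_rank A
  have : Subsingleton (Fin A.rank) := Fin.subsingleton_iff_le_one.2 (by omega)
  have hswap : ∀ x y x' y', A x y * A x' y' = A x y' * A x' y := by
    intro x y x' y'
    simp only [huv, dotProduct, Finset.sum_mul_sum]
    refine Finset.sum_congr rfl fun a _ => Finset.sum_congr rfl fun b _ => ?_
    rw [Subsingleton.elim b a]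
    ring
  let x₀ : Fin n → Bool := fun j => decide ((j : ℕ) < i)
  let x₁ : Fin n → Bool := fun j => decide ((j : ℕ) < i + 1)
  let y₀ : Fin n → Bool := fun _ => false
  let y₁ : Fin n → Bool := fun j => decide ((j : ℕ) = i + 1)
  have hrange : ∀ k ≤ n, (Finset.range n).filter (fun j => decide (j < k) = true) =
      Finset.range k := by
    intro k hk
    ext j
    simp only [Finset.mem_filter, Finset.mem_range, decide_eq_true_eq]
    omega
  have h00 : hamW (bxor x₀ y₀) = i := by
    rw [show bxor x₀ y₀ = fun j : Fin n => decide ((j : ℕ) < i) by ext j; simp [bxor, x₀, y₀],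
      hamW_val_eq_card fun j => decide (j < i), hrange i (by omega), Finset.card_range]
  have h10 : hamW (bxor x₁ y₀) = i + 1 := by
    rw [show bxor x₁ y₀ = fun j : Fin n => decide ((j : ℕ) < i + 1) by
        ext j; simp [bxor, x₁, y₀],
      hamW_val_eq_card fun j => decide (j < i + 1), hrange _ (by omega), Finset.card_range]
  have h11 : hamW (bxor x₁ y₁) = i + 2 := by
    rw [show bxor x₁ y₁ = fun j : Fin n => decide ((j : ℕ) < i + 2) by
        ext j
        simp only [bxor, x₁, y₁]
        rcases lt_trichotomy (j : ℕ) (i + 1) with h | h | h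
        · simp [h, h.ne, h.trans (Nat.lt_succ_self (i + 1))]
        · simp [h]
        · simp [h.not_gt, h.ne', show ¬ (j : ℕ) < i + 2 by omega],
      hamW_val_eq_card fun j => decide (j < i + 2), hrange _ (by omega), Finset.card_range]
  have h01 : hamW (bxor x₀ y₁) = i + 1 := by
    rw [show bxor x₀ y₁ = fun j : Fin n => decide ((j : ℕ) < i ∨ (j : ℕ) = i + 1) by
        ext j
        simp only [bxor, x₀, y₁]
        by_cases h : (j : ℕ) < i
        · simp [h, show (j : ℕ) ≠ i + 1 by omega]
        · simp [h],
      hamW_val_eq_card fun j => decide (j < i ∨ j = i + 1)]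
    have : (Finset.range n).filter (fun j => decide (j < i ∨ j = i + 1) = true) =
        insert (i + 1) (Finset.range i) := by
      ext j
      simp only [Finset.mem_filter, Finset.mem_range, decide_eq_true_eq, Finset.mem_insert]
      omega
    rw [this, Finset.card_insert_of_notMem (by simp), Finset.card_range]
  have e00 := hA x₀ y₀
  have e01 := hA x₀ y₁
  have e10 := hA x₁ y₀
  have e11 := hA x₁ y₁
  rw [h00] at e00
  rw [h01] at e01
  rw [h10] at e10
  rw [h11] at e11
  have h1 := mul_pos e00 e11
  have h2 := mul_pos e01 e10
  have h3 := hswap x₀ y₀ x₁ y₁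
  rcases hD i (by omega) with g1 | g1 <;> rcases hD (i + 1) (by omega) with g2 | g2 <;>
    rcases hD (i + 2) hi with g3 | g3 <;> rw [g1, g3] at hflip h1 <;> rw [g2] at h2 <;>
    first | exact hflip rfl | nlinarith

/-- The rank of a matrix which sign-represents `D (|x ⊕ y|)` is exponential in the number of sign
changes of `D` at distance two. -/
theorem card_flips_le_logb_rank (n ℓ : ℕ) (hℓ : 1 ≤ ℓ) (hn : n ≤ 2 ^ ℓ) (D : ℕ → ℝ)
    (hD : ∀ i ≤ n, D i = 1 ∨ D i = -1) (A : Matrix (Fin n → Bool) (Fin n → Bool) ℝ)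
    (hA : ∀ x y, 0 < A x y * D (hamW (bxor x y))) :
    (((Finset.range (n - 1)).filter fun i => D i ≠ D (i + 2)).card : ℝ) ≤
      2 ^ 33 * ℓ ^ 4 * Real.logb 2 A.rank := by
  classical
  set S := (Finset.range (n - 1)).filter fun i => D i ≠ D (i + 2) with hS
  set M := 20 * 2 ^ 26 * ℓ ^ 4 with hM
  have hM0 : 0 < M := by positivity
  have hpos : 0 < A.rank := rank_pos_of_apply_ne_zero A (fun _ => false) (fun _ => false)
    fun h => by simpa [h] using hA (fun _ => false) (fun _ => false)
  have hMℓ : (4 * M : ℝ) ≤ 2 ^ 33 * (ℓ : ℝ) ^ 4 := by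
    rw [hM]
    push_cast
    have : (0 : ℝ) ≤ (ℓ : ℝ) ^ 4 := by positivity
    linarith
  have hlog0 : 0 ≤ Real.logb 2 A.rank :=
    Real.logb_nonneg (by norm_num) (by exact_mod_cast hpos)
  suffices h : (S.card : ℝ) ≤ 4 * M * Real.logb 2 A.rank from
    h.trans (mul_le_mul_of_nonneg_right hMℓ hlog0)
  have hmem : ∀ i ∈ S, i + 2 ≤ n ∧ D i ≠ D (i + 2) := by
    intro i hi
    obtain ⟨h1, h2⟩ := Finset.mem_filter.1 hi
    rw [Finset.mem_range] at h1
    exact ⟨by omega, h2⟩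
  rcases Nat.lt_or_ge S.card M with hk | hk
  · rcases S.eq_empty_or_nonempty with h0 | ⟨i, hi⟩
    · rw [h0, Finset.card_empty, Nat.cast_zero]
      positivity
    · have h2 := two_le_rank_of_flip n i (hmem i hi).1 D hD (hmem i hi).2 A hA
      have h1 : 1 ≤ Real.logb 2 A.rank := by
        rw [Real.le_logb_iff_rpow_le (by norm_num) (by exact_mod_cast hpos), Real.rpow_one]
        exact_mod_cast h2
      have h3 : (S.card : ℝ) ≤ M := by exact_mod_cast hk.le
      have h4 : (0 : ℝ) < M := by exact_mod_cast hM0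
      nlinarith
  · set r := S.card / M with hr
    have hr1 : 1 ≤ r := (Nat.one_le_div_iff hM0).2 hk
    have hrM : r * M ≤ S.card := Nat.div_mul_le_self _ _
    have hkr : S.card < (r + 1) * M := by
      rw [mul_comm]
      exact Nat.lt_mul_div_succ _ hM0
    have key : 2 ^ r ≤ A.rank ^ 2 := by
      set S₁ := S.filter fun i => 2 * i + 2 ≤ n with hS₁
      set S₂ := (S.filter fun i => ¬ 2 * i + 2 ≤ n).image fun i => n - 2 - i with hS₂
      have hcard₂ : S₂.card = (S.filter fun i => ¬ 2 * i + 2 ≤ n).card := by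
        refine Finset.card_image_of_injOn fun i hi j hj h => ?_
        have h1 := (hmem i (Finset.mem_filter.1 hi).1).1
        have h2 := (hmem j (Finset.mem_filter.1 hj).1).1
        omega
      have hsum : S₁.card + S₂.card = S.card := by
        rw [hcard₂]
        exact Finset.card_filter_add_card_filter_not _
      have hM2 : r * M = 2 * (10 * 2 ^ 26 * ℓ ^ 4 * r) := by rw [hM]; ring
      rcases (by omega : 10 * 2 ^ 26 * ℓ ^ 4 * r ≤ S₁.card ∨
        10 * 2 ^ 26 * ℓ ^ 4 * r ≤ S₂.card) with h | h
      · exact two_pow_le_rank_sq n ℓ r hℓ hr1 hn D hD A hA S₁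
          (fun i hi => (Finset.mem_filter.1 hi).2)
          (fun i hi => (hmem i (Finset.mem_filter.1 hi).1).2) h
      · have h1 := two_pow_le_rank_sq n ℓ r hℓ hr1 hn (fun i => D (n - i))
          (fun i _ => hD _ (Nat.sub_le _ _)) (A.submatrix (fun x i => !x i) id)
          (fun x y => by
            have := hA (fun i => !x i) y
            rw [hamW_bxor_not] at this
            exact this) S₂
          (fun i hi => by
            obtain ⟨j, hj, rfl⟩ := Finset.mem_image.1 hi
            obtain ⟨h2, h3⟩ := Finset.mem_filter.1 hj
            have := (hmem j h2).1
            omega)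
          (fun i hi => by
            obtain ⟨j, hj, rfl⟩ := Finset.mem_image.1 hi
            obtain ⟨h2, h3⟩ := Finset.mem_filter.1 hj
            obtain ⟨h4, h5⟩ := hmem j h2
            rw [show n - (n - 2 - j) = j + 2 by omega, show n - (n - 2 - j + 2) = j by omega]
            exact h5.symm) h
        exact h1.trans (Nat.pow_le_pow_left (Matrix.rank_submatrix_le _ _ _) 2)
    have hlog : (r : ℝ) ≤ 2 * Real.logb 2 A.rank := by
      have h1 : ((2 : ℝ) ^ r) ≤ (A.rank : ℝ) ^ 2 := by exact_mod_cast key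
      have h2 := Real.logb_le_logb_of_le (b := 2) (by norm_num) (by positivity) h1
      rw [Real.logb_pow, Real.logb_pow, Real.logb_self_eq_one (by norm_num)] at h2
      simpa using h2
    have h3 : (S.card : ℝ) ≤ ((r : ℝ) + 1) * M := by exact_mod_cast hkr.le
    have h4 : (0 : ℝ) < M := by exact_mod_cast hM0
    have h5 : (1 : ℝ) ≤ r := by exact_mod_cast hr1
    nlinarith

/-- Lower bound of the main theorem: for the symmetric XOR function `F(x,y) = D(|x ⊕ y|)`,
`log₂ rk±(F) ≥ c · deg₂(D) / (log₂ n)^5` for a universal constant `c > 0`. -/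
theorem xor_signRank_lower_bound :
    ∃ c : ℝ, 0 < c ∧ ∀ n : ℕ, 2 ≤ n → ∀ D : ℕ → ℤ,
      (∀ i ≤ n, D i = 1 ∨ D i = -1) →
      c * (((Finset.range (n - 1)).filter (fun i => D i ≠ D (i + 2))).card : ℝ) /
          (Real.logb 2 n) ^ 5 ≤
        Real.logb 2
          (signRank (fun x y : Fin n → Bool => (D (hamW (bxor x y)) : ℝ))) := by
  refine ⟨(2 ^ 37)⁻¹, by positivity, fun n hn D hD => ?_⟩
  have hDR : ∀ i ≤ n, (D i : ℝ) = 1 ∨ (D i : ℝ) = -1 := fun i hi => by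
    exact_mod_cast hD i hi
  have hle : ∀ x : Fin n → Bool, hamW x ≤ n := fun x =>
    (Finset.card_filter_le _ _).trans_eq (by simp)
  obtain ⟨A, hA, hrank⟩ := exists_rank_eq_signRank
    (fun x y : Fin n → Bool => (D (hamW (bxor x y)) : ℝ)) fun x y => by
      rcases hDR _ (hle (bxor x y)) with h | h <;> simp only [h] <;> norm_num
  have hn0 : (0 : ℝ) < n := by exact_mod_cast (by omega : 0 < n)
  have hL1 : 1 ≤ Real.logb 2 n := by
    rw [Real.le_logb_iff_rpow_le (by norm_num) hn0, Real.rpow_one]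
    exact_mod_cast hn
  have hℓ1 : 1 ≤ Nat.clog 2 n := Nat.clog_pos (by norm_num) hn
  have hℓL : (Nat.clog 2 n : ℝ) ≤ 2 * Real.logb 2 n := by
    have h1 : 2 ^ (Nat.clog 2 n - 1) < n := Nat.pow_pred_clog_lt_self (by norm_num) hn
    have h2 : ((Nat.clog 2 n - 1 : ℕ) : ℝ) ≤ Real.logb 2 n := by
      rw [Real.le_logb_iff_rpow_le (by norm_num) hn0, Real.rpow_natCast]
      exact_mod_cast h1.le
    rw [Nat.cast_sub hℓ1, Nat.cast_one] at h2
    linarith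
  have key := card_flips_le_logb_rank n (Nat.clog 2 n) hℓ1 (Nat.le_pow_clog (by norm_num) n)
    (fun i => (D i : ℝ)) hDR A hA
  have hS : ((Finset.range (n - 1)).filter fun i => (D i : ℝ) ≠ D (i + 2)) =
      (Finset.range (n - 1)).filter fun i => D i ≠ D (i + 2) := by
    ext i
    simp
  rw [hS, hrank] at key
  set R := Real.logb 2 (signRank (fun x y : Fin n → Bool => (D (hamW (bxor x y)) : ℝ)))
  have hR : 0 ≤ R := by
    have hp : (0 : ℝ) < 2 ^ 33 * (Nat.clog 2 n : ℝ) ^ 4 := by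
      have : (0 : ℝ) < Nat.clog 2 n := by exact_mod_cast hℓ1
      positivity
    exact nonneg_of_mul_nonneg_right ((Nat.cast_nonneg _).trans key) hp
  set L := Real.logb 2 n
  rw [div_le_iff₀ (by positivity), inv_mul_le_iff₀ (by positivity)]
  refine key.trans ?_
  have h4 : (Nat.clog 2 n : ℝ) ^ 4 ≤ (2 * L) ^ 4 := pow_le_pow_left₀ (Nat.cast_nonneg _) hℓL 4
  have h5 : L ^ 4 ≤ L ^ 5 := pow_le_pow_right₀ hL1 (by norm_num)
  calc 2 ^ 33 * (Nat.clog 2 n : ℝ) ^ 4 * R ≤ 2 ^ 33 * (2 ^ 4 * L ^ 5) * R := by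
        gcongr
        rw [mul_pow] at h4
        linarith
    _ = 2 ^ 37 * (R * L ^ 5) := by ring
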